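/- arXiv:1408.3428 — 9 statements merged into one kernel-verified Lean document; each statement's English description precedes it below -/
import Mathlib

section
/- There exists a continuous surjective map h : ℝ² → ℝ² such that for every z ∈ ℝ², the fiber h⁻¹({z}) contains at least two points, and h is cellular: for every z ∈ ℝ² there is a sequence (Dₙ)ₙ of compact subsets of ℝ², each homeomorphic to the closed unit disk of ℝ², with D_{n+1} contained in the interior of Dₙ for every n and ⋂ₙ Dₙ = h⁻¹({z}). -/
open Metric Set Function

/-- A map `h : ℝ² → ℝ²` is cellular if every fiber is a decreasing intersection of
compact sets homeomorphic to the closed unit disk, each contained in the interior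
of the previous one. -/
def IsCellularMap (h : EuclideanSpace ℝ (Fin 2) → EuclideanSpace ℝ (Fin 2)) : Prop :=
  ∀ z : EuclideanSpace ℝ (Fin 2), ∃ D : ℕ → Set (EuclideanSpace ℝ (Fin 2)),
    (∀ n, IsCompact (D n)) ∧
    (∀ n, Nonempty (D n ≃ₜ (Metric.closedBall (0 : EuclideanSpace ℝ (Fin 2)) 1))) ∧
    (∀ n, D (n + 1) ⊆ interior (D n)) ∧
    (⋂ n, D n) = h ⁻¹' {z}

/-- The Euclidean plane. -/
local notation "𝔼" => EuclideanSpace ℝ (Fin 2)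

/-- The point of the integer lattice with coordinates `v`. -/
noncomputable def latticePoint (v : Fin 2 → ℤ) : 𝔼 := WithLp.toLp 2 fun i => (v i : ℝ)

/-- A self-map of the plane is lattice equivariant if it commutes with integer translations. -/
def LatticeEquivariant (f : 𝔼 → 𝔼) : Prop :=
  ∀ x v, f (x + latticePoint v) = f x + latticePoint v

lemma LatticeEquivariant.comp {f g : 𝔼 → 𝔼} (hf : LatticeEquivariant f)
    (hg : LatticeEquivariant g) : LatticeEquivariant (f ∘ g) := fun x v => by
  simp only [comp_apply, hg x v, hf (g x) v]

/-- The shear which moves `x` in the direction `j` by a periodic function of `x i`. -/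
noncomputable def shear (i j : Fin 2) (hij : i ≠ j) (f : C(AddCircle (1 : ℝ), ℝ)) :
    𝔼 ≃ₜ 𝔼 where
  toFun x := x + EuclideanSpace.single j (f (x i : AddCircle (1 : ℝ)))
  invFun x := x - EuclideanSpace.single j (f (x i : AddCircle (1 : ℝ)))
  left_inv x := by simp [hij]
  right_inv x := by simp [hij]
  continuous_toFun := by
    have : Continuous fun x : 𝔼 => f (x i : AddCircle (1 : ℝ)) :=
      f.continuous.comp ((AddCircle.continuous_mk' 1).comp (by fun_prop))
    exact continuous_id.add ((PiLp.continuous_toLp 2 _).comp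
      ((continuous_single (A := fun _ : Fin 2 => ℝ) j).comp this))
  continuous_invFun := by
    have : Continuous fun x : 𝔼 => f (x i : AddCircle (1 : ℝ)) :=
      f.continuous.comp ((AddCircle.continuous_mk' 1).comp (by fun_prop))
    exact continuous_id.sub ((PiLp.continuous_toLp 2 _).comp
      ((continuous_single (A := fun _ : Fin 2 => ℝ) j).comp this))

lemma shear_apply (i j : Fin 2) (hij : i ≠ j) (f : C(AddCircle (1 : ℝ), ℝ)) (x : 𝔼) :
    shear i j hij f x = x + EuclideanSpace.single j (f (x i : AddCircle (1 : ℝ))) := rfl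

lemma dist_shear_self (i j : Fin 2) (hij : i ≠ j) (f : C(AddCircle (1 : ℝ), ℝ)) (x : 𝔼) :
    dist (shear i j hij f x) x = |f (x i : AddCircle (1 : ℝ))| := by
  simp [shear_apply, dist_eq_norm]

lemma latticeEquivariant_shear (i j : Fin 2) (hij : i ≠ j) (f : C(AddCircle (1 : ℝ), ℝ)) :
    LatticeEquivariant (shear i j hij f) := fun x v => by
  have h : (((x + latticePoint v) i : ℝ) : AddCircle (1 : ℝ)) = (x i : AddCircle (1 : ℝ)) := by
    simp [latticePoint]
  rw [shear_apply, shear_apply, h]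
  abel

lemma exists_injective_forall_mem {ι α : Type*} [Finite ι] {S : ι → Set α}
    (hS : ∀ i, (S i).Infinite) : ∃ a : ι → α, Injective a ∧ ∀ i, a i ∈ S i := by
  classical
  have := Fintype.ofFinite ι
  suffices h : ∀ s : Finset ι, ∃ a : ι → α, InjOn a s ∧ ∀ i, a i ∈ S i by
    obtain ⟨a, ha, h⟩ := h Finset.univ
    exact ⟨a, by simpa using ha, h⟩
  intro s
  induction s using Finset.induction_on with
  | empty =>
    choose a ha using fun i => (hS i).nonempty
    exact ⟨a, by simp, ha⟩
  | insert k s hk ih =>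
    obtain ⟨a, ha, haS⟩ := ih
    obtain ⟨y, hy, hys⟩ := (hS k).exists_notMem_finset (s.image a)
    refine ⟨update a k y, ?_, fun i => ?_⟩
    · have heq : EqOn (update a k y) a s := fun i hi =>
        update_of_ne (by rintro rfl; exact hk hi) _ _
      rw [Finset.coe_insert, injOn_insert (by simpa using hk)]
      refine ⟨ha.congr heq.symm, ?_⟩
      rw [heq.image_eq]
      simpa using hys
    · by_cases h : i = k
      · subst h; simpa using hy
      · simpa [h] using haS i

lemma infinite_image_coord {U : Set 𝔼} (hU : IsOpen U) (hne : U.Nonempty) (i : Fin 2) :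
    ((fun x : 𝔼 => (x i : AddCircle (1 : ℝ))) '' U).Infinite := by
  have h1 : IsOpenMap fun x : 𝔼 => x i :=
    (isOpenMap_eval i).comp (PiLp.homeomorph 2 (fun _ : Fin 2 => ℝ)).isOpenMap
  have h2 : IsOpenMap fun x : 𝔼 => (x i : AddCircle (1 : ℝ)) :=
    (QuotientAddGroup.isOpenMap_coe (N := AddSubgroup.zmultiples (1 : ℝ))).comp h1
  obtain ⟨x, hx⟩ := hne
  have : Nontrivial (AddCircle (1 : ℝ)) := ⟨((1 / 2 : ℝ) : AddCircle (1 : ℝ)), 0, fun h => by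
    obtain ⟨n, hn⟩ := (AddCircle.coe_eq_zero_iff (1 : ℝ)).1 h
    have h' : ((2 * n : ℤ) : ℝ) = (1 : ℤ) := by
      rw [zsmul_eq_mul] at hn
      push_cast
      linarith
    have := Int.cast_injective h'
    omega⟩
  exact infinite_of_mem_nhds _ ((h2 U hU).mem_nhds (mem_image_of_mem _ hx))

lemma exists_points_injective_coord {ι : Type*} [Finite ι] {U : ι → Set 𝔼}
    (hU : ∀ k, IsOpen (U k)) (hne : ∀ k, (U k).Nonempty) (i : Fin 2) :
    ∃ p : ι → 𝔼, (∀ k, p k ∈ U k) ∧ Injective fun k => (p k i : AddCircle (1 : ℝ)) := by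
  obtain ⟨a, ha, haU⟩ :=
    exists_injective_forall_mem fun k => infinite_image_coord (hU k) (hne k) i
  choose p hp hpa using haU
  exact ⟨p, hp, by simpa only [hpa] using ha⟩

lemma exists_continuousMap_interpolating {ι X : Type*} [Finite ι] [TopologicalSpace X]
    [NormalSpace X] [T1Space X] {a : ι → X} (ha : Injective a) {r : ℝ} (hr : 0 ≤ r)
    {w : ι → ℝ} (hw : ∀ k, |w k| ≤ r) :
    ∃ f : C(X, ℝ), (∀ k, f (a k) = w k) ∧ ∀ x, |f x| ≤ r := by
  let _ : TopologicalSpace ι := ⊥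
  have : DiscreteTopology ι := ⟨rfl⟩
  have hcl : Topology.IsClosedEmbedding a :=
    .of_continuous_injective_isClosedMap continuous_of_discreteTopology ha
      fun s _ => (s.toFinite.image a).isClosed
  obtain ⟨f, hf, hfw⟩ :=
    BoundedContinuousFunction.exists_extension_forall_mem_Icc_of_isClosedEmbedding
    (BoundedContinuousFunction.ofNormedAddCommGroupDiscrete w r hw) (a := -r) (b := r)
    (fun k => abs_le.1 (hw k)) (by linarith) hcl
  exact ⟨f, fun k => congrFun hfw k, fun x => abs_le.2 (hf x)⟩

/-- Finitely many small open sets can be pushed simultaneously so as to meet prescribed nearby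
open sets, by a lattice equivariant homeomorphism close to the identity. -/
lemma exists_homeomorph_push {ι : Type*} [Finite ι] {U V : ι → Set 𝔼}
    (hU : ∀ k, IsOpen (U k)) (hUne : ∀ k, (U k).Nonempty)
    (hV : ∀ k, IsOpen (V k)) (hVne : ∀ k, (V k).Nonempty) {r : ℝ} (hr : 0 ≤ r)
    (hUV : ∀ k, ∀ u ∈ U k, ∀ v ∈ V k, dist u v ≤ r) :
    ∃ ψ : 𝔼 ≃ₜ 𝔼, LatticeEquivariant ψ ∧ (∀ x, dist (ψ x) x ≤ 2 * r) ∧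
      ∀ k, ∃ u ∈ U k, ψ u ∈ V k := by
  obtain ⟨p, hpU, hp⟩ := exists_points_injective_coord hU hUne 0
  obtain ⟨q, hqV, hq⟩ := exists_points_injective_coord hV hVne 1
  have hpq : ∀ i k, |q k i - p k i| ≤ r := fun i k => by
    have h := PiLp.norm_apply_le (q k - p k) i
    rw [← dist_eq_norm, dist_comm] at h
    exact h.trans (hUV k _ (hpU k) _ (hqV k))
  obtain ⟨f, hf, hfr⟩ := exists_continuousMap_interpolating (X := AddCircle (1 : ℝ)) hp hr (hpq 1)
  obtain ⟨g, hg, hgr⟩ := exists_continuousMap_interpolating (X := AddCircle (1 : ℝ)) hq hr (hpq 0)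
  refine ⟨(shear 0 1 zero_ne_one f).trans (shear 1 0 one_ne_zero g),
    (latticeEquivariant_shear 1 0 one_ne_zero g).comp
      (latticeEquivariant_shear 0 1 zero_ne_one f),
    fun x => ?_, fun k => ⟨p k, hpU k, ?_⟩⟩
  · rw [Homeomorph.trans_apply, two_mul]
    refine (dist_triangle _ (shear 0 1 zero_ne_one f x) _).trans (add_le_add ?_ ?_)
    · rw [dist_shear_self]; exact hgr _
    · rw [dist_shear_self]; exact hfr _
  · convert hqV k using 1
    have h1 := hf k
    have h2 := hg k
    simp only at h1 h2
    ext i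
    fin_cases i <;> simp [shear_apply, h1, h2]

lemma exists_lattice_translate_mem_closedBall (z : 𝔼) :
    ∃ v, z + latticePoint v ∈ closedBall (0 : 𝔼) 2 := by
  refine ⟨fun i => -⌊z i⌋, ?_⟩
  have h : ∀ i, (z + latticePoint fun i => -⌊z i⌋) i = Int.fract (z i) := fun i => by
    simp [latticePoint, Int.fract, sub_eq_add_neg]
  rw [mem_closedBall_zero_iff, EuclideanSpace.norm_eq, Real.sqrt_le_left (by norm_num)]
  simp only [h, Fin.sum_univ_two, Real.norm_eq_abs, sq_abs]
  nlinarith [Int.fract_nonneg (z 0), Int.fract_nonneg (z 1), Int.fract_lt_one (z 0),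
    Int.fract_lt_one (z 1)]

/-- Every ball of radius `ε` has image of diameter greater than `1`. -/
def StretchesBalls (ε : ℝ) (g : 𝔼 → 𝔼) : Prop :=
  ∀ z, ∃ x ∈ ball z ε, ∃ y ∈ ball z ε, 1 < dist (g x) (g y)

lemma stretchesBalls_id : StretchesBalls 1 id := fun z => by
  have h : ‖EuclideanSpace.single (0 : Fin 2) (3 / 4 : ℝ)‖ = 3 / 4 := by
    rw [PiLp.norm_single]; norm_num
  refine ⟨z + EuclideanSpace.single 0 (3 / 4), ?_, z - EuclideanSpace.single 0 (3 / 4), ?_, ?_⟩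
  · rw [mem_ball, dist_self_add_left, h]; norm_num
  · rw [mem_ball, dist_self_sub_left, h]; norm_num
  · have h2 : id (z + EuclideanSpace.single 0 (3 / 4)) - id (z - EuclideanSpace.single 0 (3 / 4))
        = (2 : ℝ) • EuclideanSpace.single (0 : Fin 2) (3 / 4 : ℝ) := by
      simp only [id, two_smul]; abel
    rw [dist_eq_norm, h2, norm_smul, h]; norm_num

lemma LatticeEquivariant.stretchesBalls {g : 𝔼 → 𝔼} (hg : LatticeEquivariant g) {ε : ℝ}
    (h : ∀ z ∈ closedBall (0 : 𝔼) 2, ∃ x ∈ ball z ε, ∃ y ∈ ball z ε, 1 < dist (g x) (g y)) :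
    StretchesBalls ε g := fun z => by
  obtain ⟨v, hv⟩ := exists_lattice_translate_mem_closedBall z
  obtain ⟨x, hx, y, hy, hxy⟩ := h _ hv
  have hg' : ∀ x, g (x - latticePoint v) = g x - latticePoint v := fun x => by
    rw [eq_sub_iff_add_eq, ← hg, sub_add_cancel]
  refine ⟨x - latticePoint v, ?_, y - latticePoint v, ?_, ?_⟩
  · rwa [mem_ball, dist_eq_norm, sub_sub, add_comm _ z, ← dist_eq_norm]
  · rwa [mem_ball, dist_eq_norm, sub_sub, add_comm _ z, ← dist_eq_norm]
  · rwa [hg', hg', dist_sub_right]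

lemma StretchesBalls.exists_open_pair {g : 𝔼 → 𝔼} (hgc : Continuous g) {ε : ℝ}
    (h : StretchesBalls ε g) (z : 𝔼) : ∃ V : Bool → Set 𝔼, (∀ b, IsOpen (V b)) ∧
      (∀ b, (V b).Nonempty) ∧ (∀ b, V b ⊆ ball z ε) ∧
      ∀ x ∈ V true, ∀ y ∈ V false, 1 < dist (g x) (g y) := by
  obtain ⟨x, hx, y, hy, hxy⟩ := h z
  have ho : IsOpen {p : 𝔼 × 𝔼 | 1 < dist (g p.1) (g p.2)} :=
    isOpen_lt continuous_const
      ((hgc.comp continuous_fst).dist (hgc.comp continuous_snd))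
  obtain ⟨A, B, hA, hB, hxA, hyB, hAB⟩ := isOpen_prod_iff.1 ho x y hxy
  refine ⟨fun b => cond b A B ∩ ball z ε, ?_, ?_, fun b => inter_subset_right, ?_⟩
  · rintro (_ | _)
    exacts [hB.inter isOpen_ball, hA.inter isOpen_ball]
  · rintro (_ | _)
    exacts [⟨y, hyB, hy⟩, ⟨x, hxA, hx⟩]
  · intro x hx y hy
    have hmem : (x, y) ∈ A ×ˢ B := ⟨hx.1, hy.1⟩
    have hlt := hAB hmem
    rwa [mem_ofPred_eq] at hlt

lemma exists_homeomorph_stretchesBalls_comp {g : 𝔼 → 𝔼} (hgc : Continuous g)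
    (hg : LatticeEquivariant g) {ε δ : ℝ} (hε : 0 < ε) (hδ : 0 < δ) (h : StretchesBalls ε g) :
    ∃ ψ : 𝔼 ≃ₜ 𝔼, LatticeEquivariant ψ ∧ (∀ x, dist (ψ x) x ≤ 4 * ε) ∧
      StretchesBalls δ (g ∘ ψ) := by
  choose V hVo hVne hVsub hV using h.exists_open_pair hgc
  obtain ⟨t, -, ht⟩ := (isCompact_closedBall (0 : 𝔼) 2).elim_nhds_subcover
    (fun z => ball z (δ / 2)) fun z _ => ball_mem_nhds _ (half_pos hδ)
  have hm : 0 < min (δ / 2) ε := lt_min (half_pos hδ) hε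
  obtain ⟨ψ, hψ, hψε, hψV⟩ := exists_homeomorph_push (ι := t × Bool)
    (U := fun k => ball (k.1 : 𝔼) (min (δ / 2) ε)) (V := fun k => V k.1 k.2)
    (fun _ => isOpen_ball) (fun _ => nonempty_ball.2 hm) (fun _ => hVo _ _) (fun _ => hVne _ _)
    (r := 2 * ε) (by positivity) (fun k u hu v hv => by
      have h1 := (mem_ball.1 hu).trans_le (min_le_right _ _)
      have h2 := mem_ball.1 (hVsub _ _ hv)
      linarith [dist_triangle_right u v (k.1 : 𝔼)])
  refine ⟨ψ, hψ, fun x => (hψε x).trans_eq (by ring), (hg.comp hψ).stretchesBalls fun z hz => ?_⟩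
  obtain ⟨c, hct, hzc⟩ := mem_iUnion₂.1 (ht hz)
  have hball : ball c (min (δ / 2) ε) ⊆ ball z δ := fun u hu => by
    have h1 := (mem_ball.1 hu).trans_le (min_le_left _ _)
    have h2 := mem_ball'.1 hzc
    exact mem_ball.2 (by linarith [dist_triangle u c z])
  obtain ⟨u, hu, huV⟩ := hψV (⟨c, hct⟩, true)
  obtain ⟨v, hv, hvV⟩ := hψV (⟨c, hct⟩, false)
  exact ⟨u, hball hu, v, hball hv, hV c _ huV _ hvV⟩

/-- Homeomorphisms of the plane which converge uniformly, while their inverses stretch smaller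
and smaller balls. -/
lemma exists_seq_homeomorph : ∃ H : ℕ → 𝔼 ≃ₜ 𝔼, H 0 = Homeomorph.refl 𝔼 ∧
    (∀ n, StretchesBalls (1 / 2 ^ n) (H n).symm) ∧
    ∀ n x, dist (H n x) (H (n + 1) x) ≤ 8 / 2 / 2 ^ n := by
  let T : ℕ → Type := fun n =>
    {h : 𝔼 ≃ₜ 𝔼 // LatticeEquivariant h.symm ∧ StretchesBalls (1 / 2 ^ n) h.symm}
  have step : ∀ n (h : T n), ∃ h' : T (n + 1), ∀ x, dist (h.1 x) (h'.1 x) ≤ 8 / 2 / 2 ^ n := by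
    rintro n ⟨h, hh, hs⟩
    obtain ⟨ψ, hψ, hd, hs'⟩ := exists_homeomorph_stretchesBalls_comp h.symm.continuous hh
      (ε := 1 / 2 ^ n) (δ := 1 / 2 ^ (n + 1)) (by positivity) (by positivity) hs
    refine ⟨⟨h.trans ψ.symm, hh.comp hψ, hs'⟩, fun x => ?_⟩
    have := hd (ψ.symm (h x))
    rw [ψ.apply_symm_apply] at this
    exact this.trans_eq (by ring)
  choose next hnext using step
  let H : ∀ n, T n := fun n =>
    Nat.rec ⟨Homeomorph.refl 𝔼, fun _ _ => rfl, by simpa using! stretchesBalls_id⟩ next n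
  exact ⟨fun n => (H n).1, rfl, fun n => (H n).2.2, fun n x => hnext n (H n) x⟩

lemma nonempty_homeomorph_closedBall_preimage {E : Type*} [NormedAddCommGroup E]
    [NormedSpace ℝ E] (h : E ≃ₜ E) (z : E) {r : ℝ} (hr : 0 < r) :
    Nonempty (h ⁻¹' closedBall z r ≃ₜ closedBall (0 : E) 1) := by
  let φ : E ≃ₜ E := (Homeomorph.smulOfNeZero r hr.ne').trans (Homeomorph.addLeft z)
  have hφ : φ '' closedBall 0 1 = closedBall z r := by
    rw [← affinity_unitClosedBall hr.le z, ← image_smul, ← image_vadd, image_image]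
    rfl
  have : h ⁻¹' closedBall z r = (φ.trans h.symm) '' closedBall 0 1 := by
    rw [← h.image_symm, ← hφ, image_image]
    rfl
  exact ⟨((φ.trans h.symm).image _ |>.trans (Homeomorph.setCongr this.symm)).symm⟩

lemma tendsto_const_div_two_pow (C : ℝ) :
    Filter.Tendsto (fun n : ℕ => C / 2 ^ n) Filter.atTop (nhds 0) :=
  tendsto_const_nhds.div_atTop (tendsto_pow_atTop_atTop_of_one_lt one_lt_two)

lemma exists_ne_mem_fiber_of_stretchesBalls {H : ℕ → 𝔼 ≃ₜ 𝔼} (hH0 : H 0 = Homeomorph.refl 𝔼)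
    (hstretch : ∀ n, StretchesBalls (1 / 2 ^ n) (H n).symm) {h : 𝔼 → 𝔼} (hcont : Continuous h)
    (hHh : ∀ n x, dist (H n x) (h x) ≤ 8 / 2 ^ n) (z : 𝔼) :
    ∃ a ∈ h ⁻¹' {z}, ∃ b ∈ h ⁻¹' {z}, a ≠ b := by
  choose x hx y hy hxy using fun n => hstretch n z
  have hnear : ∀ n, ∀ x ∈ ball z (1 / 2 ^ n), dist (h ((H n).symm x)) z ≤ 9 / 2 ^ n := by
    intro n x hx
    have h1 := hHh n ((H n).symm x)
    rw [(H n).apply_symm_apply, dist_comm] at h1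
    have h2 := mem_ball.1 hx
    have h3 : (9 : ℝ) / 2 ^ n = 8 / 2 ^ n + 1 / 2 ^ n := by ring
    linarith [dist_triangle (h ((H n).symm x)) x z]
  have hbdd : ∀ n, ∀ x ∈ ball z (1 / 2 ^ n), (H n).symm x ∈ closedBall z 17 := by
    intro n x hx
    have h1 := hHh 0 ((H n).symm x)
    simp only [hH0, Homeomorph.refl_apply, id, pow_zero, div_one] at h1
    have h2 : (9 : ℝ) / 2 ^ n ≤ 9 := div_le_self (by norm_num) (one_le_pow₀ one_le_two)
    exact mem_closedBall.2
      (by linarith [hnear n x hx, dist_triangle ((H n).symm x) (h ((H n).symm x)) z])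
  obtain ⟨⟨a, b⟩, -, φ, hφ, hab⟩ :=
    ((isCompact_closedBall z 17).prod (isCompact_closedBall z 17)).tendsto_subseq
      fun n => mk_mem_prod (hbdd n _ (hx n)) (hbdd n _ (hy n))
  have ha := (continuous_fst.tendsto _).comp hab
  have hb := (continuous_snd.tendsto _).comp hab
  have hz : ∀ x : ℕ → 𝔼, (∀ n, x n ∈ ball z (1 / 2 ^ n)) → ∀ a,
      Filter.Tendsto (fun n => (H (φ n)).symm (x (φ n))) Filter.atTop (nhds a) → h a = z := by
    intro x hx a ha
    refine tendsto_nhds_unique ((hcont.tendsto a).comp ha) (tendsto_iff_dist_tendsto_zero.2 ?_)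
    exact squeeze_zero (fun _ => dist_nonneg) (fun n => hnear (φ n) _ (hx _))
      ((tendsto_const_div_two_pow 9).comp hφ.tendsto_atTop)
  refine ⟨a, hz x hx a ha, b, hz y hy b hb, fun hne => ?_⟩
  have : 1 ≤ dist a b := ge_of_tendsto' (ha.dist hb) fun n => (hxy (φ n)).le
  rw [hne, dist_self] at this
  linarith

lemma isCellularMap_of_homeomorph_approx {H : ℕ → 𝔼 ≃ₜ 𝔼} {h : 𝔼 → 𝔼}
    (hdist : ∀ n x, dist (H n x) (H (n + 1) x) ≤ 8 / 2 / 2 ^ n)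
    (hHh : ∀ n x, dist (H n x) (h x) ≤ 8 / 2 ^ n) : IsCellularMap h := by
  intro z
  have hh : ∀ x, Filter.Tendsto (fun n => H n x) Filter.atTop (nhds (h x)) := fun x =>
    tendsto_iff_dist_tendsto_zero.2 (squeeze_zero (fun _ => dist_nonneg) (fun n => hHh n x)
      (tendsto_const_div_two_pow 8))
  refine ⟨fun n => H n ⁻¹' closedBall z (32 / 2 ^ n), fun n => ?_, fun n => ?_, fun n => ?_, ?_⟩
  · exact (H n).isCompact_preimage.2 (isCompact_closedBall _ _)
  · exact nonempty_homeomorph_closedBall_preimage (H n) z (by positivity)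
  · refine Subset.trans (fun x hx => ?_)
      (interior_maximal (preimage_mono ball_subset_closedBall)
        (isOpen_ball.preimage (H n).continuous))
    have h1 := mem_closedBall.1 (mem_preimage.1 hx)
    have h2 : (0 : ℝ) < 1 / 2 ^ n := by positivity
    have h3 : (32 : ℝ) / 2 ^ (n + 1) = 16 * (1 / 2 ^ n) := by ring
    have h4 : (8 : ℝ) / 2 / 2 ^ n = 4 * (1 / 2 ^ n) := by ring
    have h5 : (32 : ℝ) / 2 ^ n = 32 * (1 / 2 ^ n) := by ring
    rw [mem_preimage, mem_ball]
    linarith [hdist n x, dist_triangle (H n x) (H (n + 1) x) z]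
  · ext x
    simp only [mem_iInter, mem_preimage, mem_closedBall, mem_singleton_iff]
    constructor
    · exact fun hx => tendsto_nhds_unique (hh x) (tendsto_iff_dist_tendsto_zero.2
        (squeeze_zero (fun _ => dist_nonneg) hx (tendsto_const_div_two_pow 32)))
    · rintro rfl n
      exact (hHh n x).trans (by gcongr; norm_num)

/-- There is a continuous surjection of the plane, all of whose fibers are
nontrivial cellular sets. -/
theorem exists_cellular_surjection_with_nontrivial_fibers :
    ∃ h : EuclideanSpace ℝ (Fin 2) → EuclideanSpace ℝ (Fin 2),
      Continuous h ∧ Surjective h ∧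
      (∀ z, ∃ a ∈ h ⁻¹' {z}, ∃ b ∈ h ⁻¹' {z}, a ≠ b) ∧
      IsCellularMap h := by
  obtain ⟨H, hH0, hstretch, hdist⟩ := exists_seq_homeomorph
  choose h hh using fun x =>
    cauchySeq_tendsto_of_complete (cauchySeq_of_le_geometric_two (hdist · x))
  have hHh : ∀ n x, dist (H n x) (h x) ≤ 8 / 2 ^ n := fun n x =>
    dist_le_of_le_geometric_two_of_tendsto (hdist · x) (hh x) n
  have hcont : Continuous h := by
    refine TendstoUniformly.continuous (F := fun n x => H n x) (p := Filter.atTop) ?_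
      (Filter.Frequently.of_forall fun n => (H n).continuous)
    rw [Metric.tendstoUniformly_iff]
    intro ε hε
    filter_upwards [(tendsto_const_div_two_pow 8).eventually_lt_const hε] with n hn x
    exact (dist_comm _ _).trans_lt ((hHh n x).trans_lt hn)
  have hfib := exists_ne_mem_fiber_of_stretchesBalls hH0 hstretch hcont hHh
  exact ⟨h, hcont, fun z => (hfib z).imp fun a ha => ha.1, hfib,
    isCellularMap_of_homeomorph_approx hdist hHh⟩
end

section
/- Let C > 0 and let f : ℝ² → ℝ² be a homeomorphism such that ‖f(x) − x/2‖ ≤ C for all x ∈ ℝ². Then there exists a unique map h : ℝ² → ℝ² such that sup_{x ∈ ℝ²} ‖h(x) − x‖ < ∞ and h(f(x)) = h(x)/2 for all x ∈ ℝ². Moreover this unique h is continuous and satisfies ‖h(x) − x‖ ≤ 2C for all x ∈ ℝ². -/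
open Metric Set Function

section Semiconjugacy

variable {E : Type*} [NormedAddCommGroup E] [NormedSpace ℝ E]

/-- A bounded map `w` with `w ∘ f = w / 2` for a surjective `f` vanishes. -/
lemma eq_zero_of_bounded_of_map_eq_half {X : Type*} {f : X → X} (hf : Surjective f) {w : X → E}
    {M : ℝ} (hM : ∀ x, ‖w x‖ ≤ M) (hw : ∀ x, w (f x) = (2 : ℝ)⁻¹ • w x) (x : X) : w x = 0 := by
  have hbound (n : ℕ) : ∀ x, ‖w x‖ ≤ M * (2⁻¹ : ℝ) ^ n := by
    induction n with
    | zero => simpa using hM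
    | succ n ih =>
      intro y
      obtain ⟨z, rfl⟩ := hf y
      rw [hw, norm_smul, Real.norm_of_nonneg (by norm_num), pow_succ]
      linarith [ih z]
  have hlim : Filter.Tendsto (fun n : ℕ => M * (2⁻¹ : ℝ) ^ n) Filter.atTop (nhds 0) := by
    simpa using (tendsto_pow_atTop_nhds_zero_of_lt_one
      (by norm_num : (0 : ℝ) ≤ 2⁻¹) (by norm_num)).const_mul M
  exact norm_le_zero_iff.mp (ge_of_tendsto' hlim fun n => hbound n x)

/-- The equation `u = g + (u ∘ e) / 2` with `g` bounded by `C` has a continuous solution bounded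
by `2 * C`. -/
lemma exists_continuous_bounded_solution [CompleteSpace E] {X : Type*} [TopologicalSpace X]
    {e : X → X} (he : Continuous e) {g : X → E} (hg : Continuous g) {C : ℝ}
    (hC : ∀ x, ‖g x‖ ≤ C) :
    ∃ u : X → E, Continuous u ∧ (∀ x, ‖u x‖ ≤ 2 * C) ∧
      ∀ x, u x = g x + (2 : ℝ)⁻¹ • u (e x) := by
  have hterm (n : ℕ) (x : X) : ‖((2 : ℝ)⁻¹ ^ n) • g (e^[n] x)‖ ≤ 2 * C / 2 / 2 ^ n := by
    rw [norm_smul, Real.norm_of_nonneg (by positivity), inv_pow, inv_mul_eq_div,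
      mul_div_cancel_left₀ C two_ne_zero]
    gcongr
    exact hC _
  have hsum : HasSum (fun n : ℕ => 2 * C / 2 / 2 ^ n) (2 * C) := hasSum_geometric_two' _
  refine ⟨fun x => ∑' n : ℕ, ((2 : ℝ)⁻¹ ^ n) • g (e^[n] x), ?_, ?_, ?_⟩
  · exact continuous_tsum (fun n => (hg.comp (he.iterate n)).const_smul _) hsum.summable hterm
  · exact fun x => tsum_of_norm_bounded hsum fun n => hterm n x
  · intro x
    have hs (y : X) : Summable fun n : ℕ => ((2 : ℝ)⁻¹ ^ n) • g (e^[n] y) :=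
      .of_norm_bounded hsum.summable fun n => hterm n y
    simp only
    rw [(hs x).tsum_eq_zero_add, ← (hs (e x)).tsum_const_smul]
    simp [pow_succ', mul_smul]

/-- A homeomorphism of a Banach space within `C` of `x ↦ x / 2` has a continuous semiconjugacy
to `x ↦ x / 2` within `2 * C` of the identity. -/
lemma exists_continuous_semiconjugacy_half [CompleteSpace E] {C : ℝ} (f : E ≃ₜ E)
    (hf : ∀ x, ‖f x - (2 : ℝ)⁻¹ • x‖ ≤ C) :
    ∃ h : E → E, Continuous h ∧ (∀ x, ‖h x - x‖ ≤ 2 * C) ∧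
      ∀ x, h (f x) = (2 : ℝ)⁻¹ • h x := by
  obtain ⟨u, hu, hbound, heq⟩ := exists_continuous_bounded_solution f.symm.continuous
    (g := fun y => (2 : ℝ)⁻¹ • f.symm y - y) (by fun_prop) (C := C) fun y => by
      simpa [norm_sub_rev] using hf (f.symm y)
  refine ⟨fun x => x + u x, by fun_prop, by simpa using hbound, fun x => ?_⟩
  have h := heq (f x)
  rw [f.symm_apply_apply] at h
  simp only [h, smul_add]
  abel

/-- Two semiconjugacies to `x ↦ x / 2` at bounded distance from the identity agree. -/
lemma semiconjugacy_half_unique {f : E → E} (hf : Surjective f) {h k : E → E}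
    (hh : (∃ M : ℝ, ∀ x, ‖h x - x‖ ≤ M) ∧ ∀ x, h (f x) = (2 : ℝ)⁻¹ • h x)
    (hk : (∃ M : ℝ, ∀ x, ‖k x - x‖ ≤ M) ∧ ∀ x, k (f x) = (2 : ℝ)⁻¹ • k x) : h = k := by
  obtain ⟨⟨M, hM⟩, hh⟩ := hh
  obtain ⟨⟨N, hN⟩, hk⟩ := hk
  funext x
  refine sub_eq_zero.mp (eq_zero_of_bounded_of_map_eq_half hf (w := fun x => h x - k x)
    (M := M + N) (fun x => ?_) (fun x => by rw [hh, hk, smul_sub]) x)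
  calc ‖h x - k x‖ = ‖(h x - x) - (k x - x)‖ := by rw [sub_sub_sub_cancel_right]
    _ ≤ M + N := (norm_sub_le _ _).trans (add_le_add (hM x) (hN x))

end Semiconjugacy

/-- For a homeomorphism of the plane at bounded distance from the homothety `x ↦ x/2`,
there is a unique bounded-distance-from-identity semiconjugacy to the homothety,
and it is continuous and within `2C` of the identity. -/
theorem exists_unique_semiconjugacy (C : ℝ) (hC : 0 < C)
    (f : EuclideanSpace ℝ (Fin 2) ≃ₜ EuclideanSpace ℝ (Fin 2))
    (hf : ∀ x, ‖f x - (2 : ℝ)⁻¹ • x‖ ≤ C) :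
    (∃! h : EuclideanSpace ℝ (Fin 2) → EuclideanSpace ℝ (Fin 2),
      (∃ M : ℝ, ∀ x, ‖h x - x‖ ≤ M) ∧ (∀ x, h (f x) = (2 : ℝ)⁻¹ • h x)) ∧
    (∀ h : EuclideanSpace ℝ (Fin 2) → EuclideanSpace ℝ (Fin 2),
      ((∃ M : ℝ, ∀ x, ‖h x - x‖ ≤ M) ∧ (∀ x, h (f x) = (2 : ℝ)⁻¹ • h x)) →
      Continuous h ∧ ∀ x, ‖h x - x‖ ≤ 2 * C) := by
  obtain ⟨h, hcont, hbound, hsemi⟩ := exists_continuous_semiconjugacy_half f hf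
  have hh : (∃ M : ℝ, ∀ x, ‖h x - x‖ ≤ M) ∧ ∀ x, h (f x) = (2 : ℝ)⁻¹ • h x :=
    ⟨⟨2 * C, hbound⟩, hsemi⟩
  refine ⟨⟨h, hh, fun k hk => semiconjugacy_half_unique f.surjective hk hh⟩, fun k hk => ?_⟩
  obtain rfl := semiconjugacy_half_unique f.surjective hk hh
  exact ⟨hcont, hbound⟩
end

section
/- Let C > 0, let f : ℝ² → ℝ² be a homeomorphism such that ‖f(x) − x/2‖ ≤ C for all x ∈ ℝ², and let h : ℝ² → ℝ² be the associated semiconjugacy. Then for every real R ≥ 4C and every x ∈ ℝ²: h⁻¹({h(x)}) = ⋂_{n ≥ 0} fⁿ( closedBall(f⁻ⁿ(x), R) ), where fⁿ denotes the n-th iterate of f and f⁻ⁿ the n-th iterate of f⁻¹. -/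
open Metric Set Function

theorem nonpos_of_forall_two_pow_mul_le {a b : ℝ} (hab : ∀ n : ℕ, 2 ^ n * a ≤ b) : a ≤ 0 := by
  by_contra! ha
  obtain ⟨n, hn⟩ := pow_unbounded_of_one_lt (b / a) (one_lt_two : (1 : ℝ) < 2)
  exact (hab n).not_gt ((div_lt_iff₀ ha).1 hn)

section Semiconjugacy

variable {E : Type*} [NormedAddCommGroup E] [NormedSpace ℝ E]

/-- A map at bounded distance from the identity that semiconjugates a `C`-perturbation of
`x ↦ x/2` to `x ↦ x/2` is `2C`-close to the identity. -/
theorem norm_semiconjugacy_sub_le {C : ℝ} {f : E → E} (hsurj : Surjective f)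
    (hf : ∀ x, ‖f x - (2 : ℝ)⁻¹ • x‖ ≤ C) {h : E → E} (hbd : ∃ M : ℝ, ∀ x, ‖h x - x‖ ≤ M)
    (hsemi : ∀ x, h (f x) = (2 : ℝ)⁻¹ • h x) (x : E) : ‖h x - x‖ ≤ 2 * C := by
  obtain ⟨M, hM⟩ := hbd
  have key : ∀ n : ℕ, ∀ y, 2 ^ n * (‖h y - y‖ - 2 * C) ≤ M - 2 * C := by
    intro n
    induction n with
    | zero => intro y; simpa using hM y
    | succ n ih =>
      intro y
      obtain ⟨z, rfl⟩ := hsurj y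
      have hz : ‖h (f z) - f z‖ ≤ 2⁻¹ * ‖h z - z‖ + C := by
        have e : h (f z) - f z = (2 : ℝ)⁻¹ • (h z - z) - (f z - (2 : ℝ)⁻¹ • z) := by
          rw [hsemi, smul_sub]; abel
        calc ‖h (f z) - f z‖ ≤ ‖(2 : ℝ)⁻¹ • (h z - z)‖ + ‖f z - (2 : ℝ)⁻¹ • z‖ := by
              rw [e]; exact norm_sub_le _ _
          _ ≤ 2⁻¹ * ‖h z - z‖ + C := by
              rw [norm_smul, Real.norm_of_nonneg (by norm_num)]
              exact add_le_add_right (hf z) _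
      calc (2 : ℝ) ^ (n + 1) * (‖h (f z) - f z‖ - 2 * C)
          = 2 ^ n * (2 * (‖h (f z) - f z‖ - 2 * C)) := by ring
        _ ≤ 2 ^ n * (‖h z - z‖ - 2 * C) := by gcongr; linarith
        _ ≤ M - 2 * C := ih z
  exact sub_nonpos.1 (nonpos_of_forall_two_pow_mul_le fun n => key n x)

theorem semiconjugacy_iterate_symm {f : E ≃ E} {h : E → E}
    (hsemi : ∀ x, h (f x) = (2 : ℝ)⁻¹ • h x) (n : ℕ) (x : E) :
    h (f.symm^[n] x) = (2 : ℝ) ^ n • h x := by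
  induction n with
  | zero => simp
  | succ n ih =>
    have hs := hsemi (f.symm (f.symm^[n] x))
    rw [f.apply_symm_apply, ih] at hs
    rw [iterate_succ_apply', pow_succ', mul_smul, hs, smul_inv_smul₀ two_ne_zero]

end Semiconjugacy

/-- The fibers of the semiconjugacy associated to a `C`-perturbation of the
homothety `x ↦ x/2` are the decreasing intersections of forward images of
pulled-back balls of any radius `R ≥ 4C`. -/
theorem fiber_eq_iInter_image_closedBall (C : ℝ) (hC : 0 < C)
    (f : EuclideanSpace ℝ (Fin 2) ≃ₜ EuclideanSpace ℝ (Fin 2))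
    (hf : ∀ x, ‖f x - (2 : ℝ)⁻¹ • x‖ ≤ C)
    (h : EuclideanSpace ℝ (Fin 2) → EuclideanSpace ℝ (Fin 2))
    (hbd : ∃ M : ℝ, ∀ x, ‖h x - x‖ ≤ M)
    (hsemi : ∀ x, h (f x) = (2 : ℝ)⁻¹ • h x) :
    ∀ R : ℝ, 4 * C ≤ R → ∀ x : EuclideanSpace ℝ (Fin 2),
      h ⁻¹' {h x} = ⋂ n : ℕ, (⇑f)^[n] '' Metric.closedBall ((⇑f.symm)^[n] x) R := by
  intro R hR x
  have hclose := norm_semiconjugacy_sub_le f.surjective hf hbd hsemi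
  have hiter : ∀ (n : ℕ) y, h (f.symm^[n] y) = (2 : ℝ) ^ n • h y :=
    semiconjugacy_iterate_symm (f := f.toEquiv) hsemi
  ext y
  have hmem : ∀ n : ℕ, y ∈ f^[n] '' closedBall (f.symm^[n] x) R ↔
      ‖f.symm^[n] y - f.symm^[n] x‖ ≤ R := by
    intro n
    rw [image_eq_preimage_of_inverse (LeftInverse.iterate f.symm_apply_apply n)
        (LeftInverse.iterate f.apply_symm_apply n),
      mem_preimage, mem_closedBall, dist_eq_norm]
  simp only [mem_preimage, mem_singleton_iff, mem_iInter, hmem]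
  constructor
  · intro hy n
    set u := f.symm^[n] y with hu
    set v := f.symm^[n] x with hv
    have huv : h u = h v := by rw [hu, hv, hiter, hiter, hy]
    have e : u - v = (h v - v) - (h u - u) := by rw [huv]; abel
    rw [e]
    linarith [norm_sub_le (h v - v) (h u - u), hclose u, hclose v]
  · intro hy
    rw [← sub_eq_zero, ← norm_le_zero_iff]
    refine nonpos_of_forall_two_pow_mul_le (b := R + 4 * C) fun n => ?_
    have hyn := hy n
    have e : ‖h (f.symm^[n] y) - h (f.symm^[n] x)‖ = 2 ^ n * ‖h y - h x‖ := by
      rw [hiter, hiter, ← smul_sub, norm_smul, Real.norm_of_nonneg (by positivity)]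
    rw [← e]
    set u := f.symm^[n] y
    set v := f.symm^[n] x
    have e' : h u - h v = (u - v) + ((h u - u) - (h v - v)) := by abel
    rw [e']
    linarith [norm_add_le (u - v) ((h u - u) - (h v - v)),
      norm_sub_le (h u - u) (h v - v), hclose u, hclose v]
end

section
/- Let C > 0, let f : ℝ² → ℝ² be a homeomorphism such that ‖f(x) − x/2‖ ≤ C for all x ∈ ℝ², and let h : ℝ² → ℝ² be the associated semiconjugacy. Then for every z ∈ ℝ², the fiber h⁻¹({z}) is nonempty, compact and connected; moreover it is cellular: there exists a sequence (Dₙ)ₙ of compact subsets of ℝ², each homeomorphic to the closed unit disk of ℝ², with D_{n+1} contained in the interior of Dₙ for every n and ⋂ₙ Dₙ = h⁻¹({z}). -/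
open Metric Set Function

/-- The intersection of a decreasing family of compact preconnected sets in a Hausdorff space is
preconnected. -/
theorem isPreconnected_iInter_of_directed {X ι : Type*} [TopologicalSpace X] [T2Space X]
    [Nonempty ι] {K : ι → Set X} (hK : Directed (· ⊇ ·) K) (hcomp : ∀ i, IsCompact (K i))
    (hconn : ∀ i, IsPreconnected (K i)) : IsPreconnected (⋂ i, K i) := by
  have hclosed : IsClosed (⋂ i, K i) := isClosed_iInter fun i => (hcomp i).isClosed
  have hcompact : IsCompact (⋂ i, K i) :=
    (hcomp (Classical.arbitrary ι)).of_isClosed_subset hclosed (iInter_subset _ _)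
  rw [isPreconnected_iff_subset_of_fully_disjoint_closed hclosed]
  intro u v hu hv huv hdisj
  obtain ⟨U, V, hU, hV, huU, hvV, hUV⟩ := SeparatedNhds.of_isCompact_isCompact
    (hcompact.inter_right hu) (hcompact.inter_right hv)
    (hdisj.mono inter_subset_right inter_subset_right)
  obtain ⟨i, hi⟩ := exists_subset_nhds_of_isCompact (U := U ∪ V) hK hcomp fun x hx =>
    (hU.union hV).mem_nhds <| (huv hx).imp (fun h => huU ⟨hx, h⟩) (fun h => hvV ⟨hx, h⟩)
  have hKi : ⋂ i, K i ⊆ K i := iInter_subset _ _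
  rcases (hconn i).subset_or_subset hU hV hUV hi with h | h
  · exact .inl fun x hx => (huv hx).resolve_right fun hxv =>
      disjoint_left.1 hUV (h (hKi hx)) (hvV ⟨hx, hxv⟩)
  · exact .inr fun x hx => (huv hx).resolve_left fun hxu =>
      disjoint_left.1 hUV (huU ⟨hx, hxu⟩) (h (hKi hx))

/-- Closed balls of positive radius in a real normed space are homeomorphic to the closed unit
ball. -/
theorem nonempty_homeomorph_closedBall_unit {E : Type*} [NormedAddCommGroup E] [NormedSpace ℝ E]
    (c : E) {r : ℝ} (hr : 0 < r) : Nonempty (closedBall c r ≃ₜ closedBall (0 : E) 1) := by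
  let e : E ≃ₜ E := (Homeomorph.smulOfNeZero r hr.ne').trans (Homeomorph.addLeft c)
  have he : e '' closedBall 0 1 = closedBall c r := by
    rw [← affinity_unitClosedBall hr.le c, ← image_smul, ← image_vadd, image_image]
    rfl
  exact ⟨((e.image _).trans (Homeomorph.setCongr he)).symm⟩

section Perturbation

variable {E : Type*} [NormedAddCommGroup E] [NormedSpace ℝ E]

theorem semiconj_half_pow {f : E ≃ₜ E} {h : E → E} (hsemi : ∀ x, h (f x) = (2 : ℝ)⁻¹ • h x)
    (n : ℕ) (x : E) : (2 : ℝ) ^ n • h ((f ^ n) x) = h x := by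
  induction n generalizing x with
  | zero => simp
  | succ n ih =>
    rw [pow_succ, pow_succ, Homeomorph.mul_apply, mul_comm, mul_smul, ih, hsemi, smul_smul]
    norm_num

theorem image_closedBall_subset_ball {C r : ℝ} {f : E ≃ₜ E}
    (hf : ∀ x, ‖f x - (2 : ℝ)⁻¹ • x‖ ≤ C) (hr : 2 * C < r) (c : E) :
    f '' closedBall ((2 : ℝ) • c) r ⊆ ball c r := by
  rintro _ ⟨y, hy, rfl⟩
  rw [mem_closedBall_iff_norm] at hy
  rw [mem_ball_iff_norm]
  have h1 : ‖(2 : ℝ)⁻¹ • (y - (2 : ℝ) • c)‖ ≤ 2⁻¹ * r := by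
    rw [norm_smul, Real.norm_of_nonneg (by norm_num)]
    gcongr
  have h2 : f y - c = (f y - (2 : ℝ)⁻¹ • y) + (2 : ℝ)⁻¹ • (y - (2 : ℝ) • c) := by
    module
  rw [h2]
  linarith [norm_add_le (f y - (2 : ℝ)⁻¹ • y) ((2 : ℝ)⁻¹ • (y - (2 : ℝ) • c)), hf y]

/-- The fiber over `z` is the intersection of the images under `f ^ n` of the closed balls around
`2 ^ n • z`. -/
theorem iInter_image_closedBall_eq_fiber {M r : ℝ} {f : E ≃ₜ E} {h : E → E}
    (hM : ∀ x, ‖h x - x‖ ≤ M) (hsemi : ∀ x, h (f x) = (2 : ℝ)⁻¹ • h x) (hr : M ≤ r) (z : E) :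
    ⋂ n : ℕ, (f ^ n) '' closedBall ((2 : ℝ) ^ n • z) r = h ⁻¹' {z} := by
  ext x
  simp only [mem_iInter, mem_preimage, mem_singleton_iff]
  constructor
  · intro hx
    have hle (n : ℕ) : 2 ^ n * ‖h x - z‖ ≤ M + r := by
      obtain ⟨y, hy, rfl⟩ := hx n
      rw [mem_closedBall_iff_norm] at hy
      calc 2 ^ n * ‖h ((f ^ n) y) - z‖ = ‖(2 : ℝ) ^ n • (h ((f ^ n) y) - z)‖ := by
            rw [norm_smul, Real.norm_of_nonneg (by positivity)]
        _ = ‖(h y - y) + (y - (2 : ℝ) ^ n • z)‖ := by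
            rw [smul_sub, semiconj_half_pow hsemi, sub_add_sub_cancel]
        _ ≤ M + r := (norm_add_le _ _).trans (add_le_add (hM y) hy)
    by_contra hne
    have hpos : 0 < ‖h x - z‖ := norm_pos_iff.2 (sub_ne_zero.2 hne)
    obtain ⟨n, hn⟩ := pow_unbounded_of_one_lt ((M + r) / ‖h x - z‖) (one_lt_two (α := ℝ))
    exact (hle n).not_gt ((div_lt_iff₀ hpos).1 hn)
  · rintro rfl n
    obtain ⟨y, rfl⟩ := (f ^ n).surjective x
    refine mem_image_of_mem _ ?_
    rw [semiconj_half_pow hsemi, mem_closedBall_iff_norm']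
    exact (hM y).trans hr

end Perturbation

/-- Every fiber of the semiconjugacy associated to a `C`-perturbation of the
homothety `x ↦ x/2` is nonempty, compact, connected and cellular. -/
theorem fibers_are_cellular (C : ℝ) (hC : 0 < C)
    (f : EuclideanSpace ℝ (Fin 2) ≃ₜ EuclideanSpace ℝ (Fin 2))
    (hf : ∀ x, ‖f x - (2 : ℝ)⁻¹ • x‖ ≤ C)
    (h : EuclideanSpace ℝ (Fin 2) → EuclideanSpace ℝ (Fin 2))
    (hbd : ∃ M : ℝ, ∀ x, ‖h x - x‖ ≤ M)
    (hsemi : ∀ x, h (f x) = (2 : ℝ)⁻¹ • h x) :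
    ∀ z : EuclideanSpace ℝ (Fin 2),
      (h ⁻¹' {z}).Nonempty ∧ IsCompact (h ⁻¹' {z}) ∧ IsConnected (h ⁻¹' {z}) ∧
      ∃ D : ℕ → Set (EuclideanSpace ℝ (Fin 2)),
        (∀ n, IsCompact (D n)) ∧
        (∀ n, Nonempty (D n ≃ₜ (Metric.closedBall (0 : EuclideanSpace ℝ (Fin 2)) 1))) ∧
        (∀ n, D (n + 1) ⊆ interior (D n)) ∧
        (⋂ n, D n) = h ⁻¹' {z} := by
  intro z
  obtain ⟨M, hM⟩ := hbd
  obtain ⟨r, hMr, hCr⟩ : ∃ r, M ≤ r ∧ 2 * C < r :=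
    ⟨max M (2 * C + 1), le_max_left _ _, (lt_add_one _).trans_le (le_max_right _ _)⟩
  have hr : 0 < r := by linarith
  let D : ℕ → Set (EuclideanSpace ℝ (Fin 2)) := fun n => (f ^ n) '' closedBall ((2 : ℝ) ^ n • z) r
  have hcomp (n : ℕ) : IsCompact (D n) := (isCompact_closedBall _ _).image (f ^ n).continuous
  have hconn (n : ℕ) : IsPreconnected (D n) :=
    (convex_closedBall _ _).isPreconnected.image _ (f ^ n).continuous.continuousOn
  have hne (n : ℕ) : (D n).Nonempty := (nonempty_closedBall.2 hr.le).image _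
  have hnest (n : ℕ) : D (n + 1) ⊆ interior (D n) := by
    have hD : D (n + 1) = (f ^ n) '' (f '' closedBall ((2 : ℝ) • (2 : ℝ) ^ n • z) r) := by
      simp only [D, image_image, smul_smul, pow_succ, mul_comm (2 : ℝ)]
      rfl
    rw [hD, ← Homeomorph.image_interior, interior_closedBall _ hr.ne']
    exact image_mono (image_closedBall_subset_ball hf hCr _)
  have hanti : Antitone D := antitone_nat_of_succ_le fun n => (hnest n).trans interior_subset
  have hInter : ⋂ n, D n = h ⁻¹' {z} := iInter_image_closedBall_eq_fiber hM hsemi hMr z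
  have hnonempty : (⋂ n, D n).Nonempty :=
    IsCompact.nonempty_iInter_of_directed_nonempty_isCompact_isClosed D hanti.directed_ge hne hcomp
      fun n => (hcomp n).isClosed
  refine ⟨hInter ▸ hnonempty, ?_, hInter ▸ ⟨hnonempty,
    isPreconnected_iInter_of_directed hanti.directed_ge hcomp hconn⟩, D, hcomp, fun n => ?_, hnest,
    hInter⟩
  · rw [← hInter]
    exact (hcomp 0).of_isClosed_subset (isClosed_iInter fun n => (hcomp n).isClosed)
      (iInter_subset _ _)
  · exact (nonempty_homeomorph_closedBall_unit _ hr).map (((f ^ n).image _).symm.trans ·)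
end

section
/- Let C > 0, let f : ℝ² → ℝ² be a homeomorphism such that ‖f(x) − x/2‖ ≤ C for all x ∈ ℝ², and let h : ℝ² → ℝ² be the associated semiconjugacy. Let V ⊆ ℝ² be a set such that f(closure(V)) ⊆ V and such that V intersects every closed Euclidean ball of radius 20C in ℝ². Then h(V) = ℝ². -/
open Metric Set Function Filter Topology

section Semiconjugacy

variable {E : Type*} [NormedAddCommGroup E] [NormedSpace ℝ E]

theorem semiconj_iterate {f h : E → E} (hsemi : ∀ x, h (f x) = (2 : ℝ)⁻¹ • h x) (n : ℕ) (x : E) :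
    h (f^[n] x) = ((2 : ℝ)⁻¹ ^ n) • h x := by
  induction n with
  | zero => simp
  | succ n ih => rw [iterate_succ_apply', hsemi, ih, smul_smul, pow_succ']

/-- A map at bounded distance from the identity which semiconjugates a homeomorphism to
`x ↦ x/2` is continuous. -/
theorem continuous_of_semiconj_half (f : E ≃ₜ E) {h : E → E} {M : ℝ}
    (hM : ∀ x, ‖h x - x‖ ≤ M) (hsemi : ∀ x, h (f x) = (2 : ℝ)⁻¹ • h x) : Continuous h := by
  have key (n : ℕ) (x : E) : h x = ((2 : ℝ)⁻¹ ^ n) • h (f.symm^[n] x) := by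
    rw [← semiconj_iterate hsemi, (LeftInverse.iterate f.apply_symm_apply n) x]
  have hlim : Tendsto (fun n : ℕ => (2 : ℝ)⁻¹ ^ n * M) atTop (𝓝 0) := by
    simpa using (tendsto_pow_atTop_nhds_zero_of_lt_one
      (by norm_num : (0 : ℝ) ≤ 2⁻¹) (by norm_num)).mul_const M
  have hunif : TendstoUniformly
      (fun (n : ℕ) x => ((2 : ℝ)⁻¹ ^ n) • f.symm^[n] x) h atTop := by
    rw [Metric.tendstoUniformly_iff]
    intro ε hε
    filter_upwards [hlim.eventually_lt_const hε] with n hn x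
    rw [key n x, dist_eq_norm, ← smul_sub, norm_smul, Real.norm_of_nonneg (by positivity)]
    exact (mul_le_mul_of_nonneg_left (hM _) (by positivity)).trans_lt hn
  exact hunif.continuous
    (Frequently.of_forall fun n => (f.symm.continuous.iterate n).const_smul _)

end Semiconjugacy

/-- A trapped region which is `20C`-dense in the plane has full image under the
semiconjugacy associated to a `C`-perturbation of the homothety `x ↦ x/2`. -/
theorem image_of_trapped_dense_set_eq_univ (C : ℝ) (hC : 0 < C)
    (f : EuclideanSpace ℝ (Fin 2) ≃ₜ EuclideanSpace ℝ (Fin 2))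
    (hf : ∀ x, ‖f x - (2 : ℝ)⁻¹ • x‖ ≤ C)
    (h : EuclideanSpace ℝ (Fin 2) → EuclideanSpace ℝ (Fin 2))
    (hbd : ∃ M : ℝ, ∀ x, ‖h x - x‖ ≤ M)
    (hsemi : ∀ x, h (f x) = (2 : ℝ)⁻¹ • h x)
    (V : Set (EuclideanSpace ℝ (Fin 2)))
    (htrap : f '' closure V ⊆ V)
    (hdense : ∀ y : EuclideanSpace ℝ (Fin 2), (V ∩ Metric.closedBall y (20 * C)).Nonempty) :
    h '' V = Set.univ := by
  obtain ⟨M, hM⟩ := hbd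
  have hcont : Continuous h := continuous_of_semiconj_half f hM hsemi
  refine eq_univ_of_forall fun z => ?_
  have hmaps : MapsTo f V V := fun x hx => htrap ⟨x, subset_closure hx, rfl⟩
  choose v hvV hvB using fun n : ℕ => hdense ((2 : ℝ) ^ n • z)
  have hvn (n : ℕ) : ‖h (v n) - (2 : ℝ) ^ n • z‖ ≤ M + 20 * C := by
    have hb : ‖v n - (2 : ℝ) ^ n • z‖ ≤ 20 * C := by
      simpa [dist_eq_norm] using hvB n
    calc ‖h (v n) - (2 : ℝ) ^ n • z‖ = ‖(h (v n) - v n) + (v n - (2 : ℝ) ^ n • z)‖ := by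
          rw [sub_add_sub_cancel]
      _ ≤ M + 20 * C := (norm_add_le _ _).trans (add_le_add (hM _) hb)
  have hwn (n : ℕ) : ‖h (f^[n] (v n)) - z‖ ≤ (2 : ℝ)⁻¹ ^ n * (M + 20 * C) := by
    have hz : z = ((2 : ℝ)⁻¹ ^ n) • ((2 : ℝ) ^ n • z) := by
      rw [smul_smul, ← mul_pow]; norm_num
    rw [semiconj_iterate hsemi]
    nth_rewrite 1 [hz]
    rw [← smul_sub, norm_smul, Real.norm_of_nonneg (by positivity)]
    exact mul_le_mul_of_nonneg_left (hvn n) (by positivity)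
  have hlim : Tendsto (fun n => h (f^[n] (v n))) atTop (𝓝 z) := by
    rw [tendsto_iff_norm_sub_tendsto_zero]
    refine squeeze_zero (fun _ => norm_nonneg _) hwn ?_
    simpa using (tendsto_pow_atTop_nhds_zero_of_lt_one
      (by norm_num : (0 : ℝ) ≤ 2⁻¹) (by norm_num)).mul_const (M + 20 * C)
  have hbdd (n : ℕ) : f^[n] (v n) ∈ closedBall z (2 * M + 20 * C) := by
    have h0 : 0 ≤ M + 20 * C := (norm_nonneg _).trans (hvn n)
    have h1 : ‖h (f^[n] (v n)) - z‖ ≤ M + 20 * C := (hwn n).trans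
      (mul_le_of_le_one_left h0 (pow_le_one₀ (by norm_num) (by norm_num)))
    have h2 := norm_sub_le_norm_sub_add_norm_sub (f^[n] (v n)) (h (f^[n] (v n))) z
    rw [norm_sub_rev _ (h _)] at h2
    rw [mem_closedBall, dist_eq_norm]
    linarith [hM (f^[n] (v n))]
  obtain ⟨w, -, φ, hφ, hw⟩ := (isCompact_closedBall z (2 * M + 20 * C)).tendsto_subseq hbdd
  have hclosed : IsClosed (f '' closure V) := f.isClosedMap _ isClosed_closure
  have hwV : w ∈ f '' closure V := by
    refine hclosed.mem_of_tendsto hw ?_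
    filter_upwards [eventually_ge_atTop 1] with k hk
    obtain ⟨m, hm⟩ := Nat.exists_eq_succ_of_ne_zero
      (Nat.one_le_iff_ne_zero.mp (hk.trans (hφ.id_le k)))
    refine ⟨f^[m] (v (φ k)), subset_closure (hmaps.iterate m (hvV _)), ?_⟩
    rw [comp_apply, ← iterate_succ_apply' (f := f), ← hm]
  exact ⟨w, htrap hwV, tendsto_nhds_unique ((hcont.tendsto w).comp hw)
    (hlim.comp hφ.tendsto_atTop)⟩
end

section
/- Let C > 0, let f : ℝ² → ℝ² be a homeomorphism such that ‖f(x) − x/2‖ ≤ C for all x ∈ ℝ², and let h : ℝ² → ℝ² be the associated semiconjugacy. Assume in addition that f⁻¹ is Lipschitz with constant L, where L ≥ 2. Then, with α = log 2 / log L, there exists C' > 0 such that for all x, y ∈ ℝ² with ‖x − y‖ ≤ 1 one has ‖h(x) − h(y)‖ ≤ C' · ‖x − y‖^α. In particular h is Hölder continuous at bounded scale. -/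
open Metric Set Function

/-- If `h` conjugates `g` to the doubling map, is at bounded distance `M` from the identity, and
`g` is `L`-Lipschitz, then `n` iterations of `g` bound the oscillation of `h`. -/
theorem norm_sub_le_of_semiconj_double {E : Type*} [NormedAddCommGroup E] [NormedSpace ℝ E]
    {g h : E → E} {M L : ℝ} (hL : 0 ≤ L) (hM : ∀ x, ‖h x - x‖ ≤ M)
    (hg : ∀ x, h (g x) = (2 : ℝ) • h x) (hlip : ∀ x y, ‖g x - g y‖ ≤ L * ‖x - y‖)
    (n : ℕ) (x y : E) : 2 ^ n * ‖h x - h y‖ ≤ 2 * M + L ^ n * ‖x - y‖ := by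
  induction n generalizing x y with
  | zero =>
    have hxy : h x - h y = (h x - x) - (h y - y) + (x - y) := by abel
    have h₁ := norm_add_le ((h x - x) - (h y - y)) (x - y)
    have h₂ := norm_sub_le (h x - x) (h y - y)
    rw [← hxy] at h₁
    linarith [hM x, hM y]
  | succ n ih =>
    calc 2 ^ (n + 1) * ‖h x - h y‖ = 2 ^ n * ‖h (g x) - h (g y)‖ := by
          rw [hg, hg, ← smul_sub, norm_smul, Real.norm_ofNat]; ring
      _ ≤ 2 * M + L ^ n * ‖g x - g y‖ := ih _ _
      _ ≤ 2 * M + L ^ n * (L * ‖x - y‖) := by gcongr; exact hlip x y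
      _ = 2 * M + L ^ (n + 1) * ‖x - y‖ := by ring

/-- A quantity bounded by `2⁻ⁿ (B + Lⁿ t)` for all `n` is `O(t ^ (log 2 / log L))`. -/
theorem le_mul_rpow_log_div_log {L B s t : ℝ} (hL : 1 < L) (hB : 0 ≤ B) (ht : 0 < t) (ht1 : t ≤ 1)
    (hs : ∀ n : ℕ, 2 ^ n * s ≤ B + L ^ n * t) :
    s ≤ 2 * (B + 1) * t ^ (Real.log 2 / Real.log L) := by
  have hlogL : 0 < Real.log L := Real.log_pos hL
  obtain ⟨n, hn, hn'⟩ := exists_nat_pow_near ((one_le_inv₀ ht).2 ht1) hL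
  have hpow : (1 : ℝ) ≤ 2 ^ (n + 1) * t ^ (Real.log 2 / Real.log L) := by
    have hlt : 1 ≤ L ^ (n + 1) * t := by
      rw [← inv_mul_cancel₀ ht.ne']; gcongr
    have hL2 : L ^ (Real.log 2 / Real.log L) = 2 := by
      rw [Real.rpow_def_of_pos (by linarith), mul_div_cancel₀ _ hlogL.ne',
        Real.exp_log two_pos]
    have h₁ := Real.one_le_rpow hlt (div_pos (Real.log_pos one_lt_two) hlogL).le
    rwa [Real.mul_rpow (by positivity) ht.le, ← Real.rpow_pow_comm (by linarith), hL2] at h₁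
  have hLt : L ^ n * t ≤ 1 := by
    rw [← inv_mul_cancel₀ ht.ne']; gcongr
  have h₂ : 2 ^ n * s ≤ B + 1 := (hs n).trans (by linarith)
  refine le_of_mul_le_mul_left ?_ (pow_pos (two_pos : (0 : ℝ) < 2) n)
  calc 2 ^ n * s ≤ (B + 1) * 1 := by linarith
    _ ≤ (B + 1) * (2 ^ (n + 1) * t ^ (Real.log 2 / Real.log L)) := by gcongr
    _ = 2 ^ n * (2 * (B + 1) * t ^ (Real.log 2 / Real.log L)) := by ring

/-- If the inverse of a `C`-perturbation `f` of the homothety `x ↦ x/2` is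
`L`-Lipschitz with `L ≥ 2`, then the associated semiconjugacy is Hölder
continuous at bounded scale with exponent `log 2 / log L`. -/
theorem semiconjugacy_holder (C : ℝ) (hC : 0 < C)
    (f : EuclideanSpace ℝ (Fin 2) ≃ₜ EuclideanSpace ℝ (Fin 2))
    (hf : ∀ x, ‖f x - (2 : ℝ)⁻¹ • x‖ ≤ C)
    (h : EuclideanSpace ℝ (Fin 2) → EuclideanSpace ℝ (Fin 2))
    (hbd : ∃ M : ℝ, ∀ x, ‖h x - x‖ ≤ M)
    (hsemi : ∀ x, h (f x) = (2 : ℝ)⁻¹ • h x)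
    (L : ℝ) (hL : 2 ≤ L)
    (hlip : ∀ x y, ‖f.symm x - f.symm y‖ ≤ L * ‖x - y‖) :
    ∃ C' : ℝ, 0 < C' ∧ ∀ x y : EuclideanSpace ℝ (Fin 2), ‖x - y‖ ≤ 1 →
      ‖h x - h y‖ ≤ C' * ‖x - y‖ ^ (Real.log 2 / Real.log L) := by
  obtain ⟨M, hM⟩ := hbd
  have hM0 : 0 ≤ M := (norm_nonneg _).trans (hM 0)
  have hg : ∀ x, h (f.symm x) = (2 : ℝ) • h x := fun x => by
    have hx := hsemi (f.symm x)
    rw [f.apply_symm_apply] at hx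
    rw [hx, smul_inv_smul₀ two_ne_zero]
  refine ⟨2 * (2 * M + 1), by positivity, fun x y hxy => ?_⟩
  rcases eq_or_ne x y with rfl | hne
  · rw [sub_self, norm_zero]; positivity
  · exact le_mul_rpow_log_div_log (by linarith) (by positivity) (norm_sub_pos_iff.2 hne) hxy
      fun n => norm_sub_le_of_semiconj_double (by linarith) hM hg hlip n x y
end

section
/- Let C > 0 and let (xₙ)_{n ∈ ℤ} be a bi-infinite sequence of points of ℝ² such that ‖x_{n+1} − xₙ/2‖ ≤ C for all n ∈ ℤ. Then there exists exactly one point y ∈ ℝ² such that ‖xₙ − 2^{−n}·y‖ ≤ 4C for all n ∈ ℤ. -/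
open Metric Set Function

section Homothety

variable {E : Type*} [NormedAddCommGroup E] [NormedSpace ℝ E]

/-- Pulling a pseudo-orbit of `x ↦ x/2` back to time zero gives points whose distances are
controlled by a geometric progression. -/
lemma norm_zpow_smul_sub_le_of_pseudo_orbit {C : ℝ} {x : ℤ → E}
    (hx : ∀ n : ℤ, ‖x (n + 1) - (2 : ℝ)⁻¹ • x n‖ ≤ C) {m n : ℤ} (hmn : m ≤ n) :
    ‖(2 : ℝ) ^ n • x n - (2 : ℝ) ^ m • x m‖ ≤ 2 * C * ((2 : ℝ) ^ n - (2 : ℝ) ^ m) := by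
  induction n, hmn using Int.leInduction with
  | base => simp
  | succ n _ ih =>
    have h2 : (2 : ℝ) ^ (n + 1) = 2 ^ n * 2 := zpow_add_one₀ two_ne_zero n
    have hstep : ‖(2 : ℝ) ^ (n + 1) • x (n + 1) - (2 : ℝ) ^ n • x n‖ ≤ 2 ^ (n + 1) * C := by
      have heq : (2 : ℝ) ^ (n + 1) • x (n + 1) - (2 : ℝ) ^ n • x n
          = (2 : ℝ) ^ (n + 1) • (x (n + 1) - (2 : ℝ)⁻¹ • x n) := by
        rw [smul_sub, smul_smul, h2, mul_inv_cancel_right₀ two_ne_zero]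
      rw [heq, norm_smul, Real.norm_of_nonneg (by positivity)]
      exact mul_le_mul_of_nonneg_left (hx n) (by positivity)
    have htri := norm_sub_le_norm_sub_add_norm_sub
      ((2 : ℝ) ^ (n + 1) • x (n + 1)) ((2 : ℝ) ^ n • x n) ((2 : ℝ) ^ m • x m)
    rw [h2] at *
    linarith

lemma norm_sub_zpow_neg_smul (n : ℤ) (a b : E) :
    ‖a - (2 : ℝ) ^ (-n) • b‖ = 2 ^ (-n) * ‖(2 : ℝ) ^ n • a - b‖ := by
  have heq : a - (2 : ℝ) ^ (-n) • b = (2 : ℝ) ^ (-n) • ((2 : ℝ) ^ n • a - b) := by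
    rw [smul_sub, smul_smul, ← zpow_add₀ two_ne_zero, neg_add_cancel, zpow_zero, one_smul]
  rw [heq, norm_smul, Real.norm_of_nonneg (by positivity)]

lemma exists_shadowing_of_pseudo_orbit [CompleteSpace E] {C : ℝ} {x : ℤ → E}
    (hx : ∀ n : ℤ, ‖x (n + 1) - (2 : ℝ)⁻¹ • x n‖ ≤ C) :
    ∃ y : E, ∀ n : ℤ, ‖x n - (2 : ℝ) ^ (-n) • y‖ ≤ 2 * C := by
  have hC : 0 ≤ C := (norm_nonneg _).trans (hx 0)
  have hcauchy : CauchySeq fun k : ℕ => (2 : ℝ) ^ (-k : ℤ) • x (-k) := by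
    refine cauchySeq_of_le_geometric (1 / 2) (2 * C) (by norm_num) fun k => ?_
    rw [dist_eq_norm]
    refine (norm_zpow_smul_sub_le_of_pseudo_orbit hx
      (by push_cast; omega)).trans ?_
    gcongr
    rw [one_div, inv_pow, ← zpow_natCast, ← zpow_neg]
    exact sub_le_self _ (by positivity)
  obtain ⟨y, hy⟩ := cauchySeq_tendsto_of_complete hcauchy
  refine ⟨y, fun n => ?_⟩
  have hlim : ‖(2 : ℝ) ^ n • x n - y‖ ≤ 2 * C * 2 ^ n := by
    refine le_of_tendsto (hy.const_sub _).norm ?_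
    filter_upwards [Filter.eventually_ge_atTop (-n).toNat] with k hk
    refine (norm_zpow_smul_sub_le_of_pseudo_orbit hx (by omega)).trans ?_
    gcongr
    exact sub_le_self _ (by positivity)
  rw [norm_sub_zpow_neg_smul]
  calc (2 : ℝ) ^ (-n) * ‖(2 : ℝ) ^ n • x n - y‖
      ≤ 2 ^ (-n) * (2 * C * 2 ^ n) := by gcongr
    _ = 2 * C := by rw [zpow_neg]; field_simp

lemma eq_of_shadowing {D : ℝ} {x : ℤ → E} {y z : E}
    (hy : ∀ n : ℤ, ‖x n - (2 : ℝ) ^ (-n) • y‖ ≤ D)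
    (hz : ∀ n : ℤ, ‖x n - (2 : ℝ) ^ (-n) • z‖ ≤ D) : y = z := by
  by_contra hne
  have hpos : 0 < ‖y - z‖ := norm_pos_iff.mpr (sub_ne_zero.mpr hne)
  obtain ⟨k, hk⟩ := pow_unbounded_of_one_lt (2 * D / ‖y - z‖) (one_lt_two : (1 : ℝ) < 2)
  rw [div_lt_iff₀ hpos] at hk
  have hyk := hy (-k)
  have hzk := hz (-k)
  rw [neg_neg, zpow_natCast] at hyk hzk
  have htri := norm_sub_le_norm_sub_add_norm_sub
    ((2 : ℝ) ^ k • y) (x (-k)) ((2 : ℝ) ^ k • z)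
  rw [← smul_sub, norm_smul, Real.norm_of_nonneg (by positivity),
    norm_sub_rev _ (x (-k))] at htri
  linarith

end Homothety

/-- Unique shadowing of pseudo-orbits of the homothety `x ↦ x/2`: every
bi-infinite `C`-pseudo-orbit is `4C`-shadowed by exactly one genuine orbit. -/
theorem unique_shadowing_of_homothety_pseudo_orbit (C : ℝ) (hC : 0 < C)
    (x : ℤ → EuclideanSpace ℝ (Fin 2))
    (hx : ∀ n : ℤ, ‖x (n + 1) - (2 : ℝ)⁻¹ • x n‖ ≤ C) :
    ∃! y : EuclideanSpace ℝ (Fin 2), ∀ n : ℤ, ‖x n - ((2 : ℝ) ^ (-n) : ℝ) • y‖ ≤ 4 * C := by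
  obtain ⟨y, hy⟩ := exists_shadowing_of_pseudo_orbit hx
  have hy' : ∀ n : ℤ, ‖x n - (2 : ℝ) ^ (-n) • y‖ ≤ 4 * C := fun n => (hy n).trans (by linarith)
  exact ⟨y, hy', fun z hz => eq_of_shadowing hz hy'⟩
end

section
/- There exists a C^∞ diffeomorphism F : ℝ² → ℝ² such that: (i) F(x) = x/2 for every x outside the open unit ball B of ℝ² centered at the origin; (ii) F(closure(B)) ⊆ B; and (iii) the maximal invariant set ⋂_{n ≥ 0} Fⁿ(closure(B)) equals the vertical segment {0} × [−1/4, 1/4]. -/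
open Metric Set Function

/-- A smooth nonnegative function on `ℝ`, vanishing on `[1, ∞)`, decreasing on `(-∞, 1]` and
taking the value `1` at `1 / 16`. -/
noncomputable def stretchProfile (s : ℝ) : ℝ :=
  Real.exp (64 / 15) * expNegInvGlue ((1 - s) / 4)

namespace stretchProfile

lemma eq_exp {s : ℝ} (hs : s < 1) : stretchProfile s = Real.exp (64 / 15 - 4 / (1 - s)) := by
  rw [stretchProfile, expNegInvGlue, if_neg (by linarith), ← Real.exp_add, inv_div,
    sub_eq_add_neg (64 / 15 : ℝ)]

lemma eq_zero {s : ℝ} (hs : 1 ≤ s) : stretchProfile s = 0 := by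
  rw [stretchProfile, expNegInvGlue.zero_of_nonpos (by linarith), mul_zero]

protected lemma nonneg (s : ℝ) : 0 ≤ stretchProfile s :=
  mul_nonneg (Real.exp_pos _).le (expNegInvGlue.nonneg _)

protected lemma contDiff {n : ℕ∞} : ContDiff ℝ n stretchProfile := by
  unfold stretchProfile
  exact contDiff_const.mul (expNegInvGlue.contDiff.comp (by fun_prop))

lemma apply_one_div_sixteen : stretchProfile (1 / 16) = 1 := by
  rw [eq_exp (by norm_num)]
  norm_num

lemma lt_one {s : ℝ} (hs : 1 / 16 < s) : stretchProfile s < 1 := by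
  rcases le_or_gt 1 s with h | h
  · rw [eq_zero h]
    exact one_pos
  · rw [eq_exp h, Real.exp_lt_one_iff, sub_neg, lt_div_iff₀ (by linarith)]
    linarith

lemma le_two {s : ℝ} (hs : 0 ≤ s) : stretchProfile s ≤ 2 := by
  rcases le_or_gt 1 s with h | h
  · rw [eq_zero h]
    exact zero_le_two
  · rw [eq_exp h, ← Real.le_log_iff_exp_le two_pos]
    have h4 : 4 ≤ 4 / (1 - s) := by
      rw [le_div_iff₀ (by linarith)]
      linarith
    linarith [Real.log_two_gt_d9]

protected lemma hasDerivAt (s : ℝ) : HasDerivAt stretchProfile (deriv stretchProfile s) s :=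
  ((stretchProfile.contDiff (n := 1)).differentiable (by norm_num) s).hasDerivAt

lemma deriv_of_one_le {s : ℝ} (hs : 1 ≤ s) : deriv stretchProfile s = 0 := by
  have h : IsLocalMin stretchProfile s := Filter.Eventually.of_forall fun t => by
    rw [eq_zero hs]
    exact stretchProfile.nonneg t
  exact h.deriv_eq_zero

lemma deriv_of_lt_one {s : ℝ} (hs : s < 1) :
    deriv stretchProfile s = -(stretchProfile s * (4 / (1 - s) ^ 2)) := by
  have hev : stretchProfile =ᶠ[nhds s] fun s => Real.exp (64 / 15 - 4 / (1 - s)) := by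
    filter_upwards [Iio_mem_nhds hs] with t ht using eq_exp ht
  have hne : 1 - s ≠ 0 := by linarith
  have h := (((hasDerivAt_const s (4 : ℝ)).div ((hasDerivAt_id' s).const_sub 1) hne).const_sub
    (64 / 15)).exp
  rw [hev.deriv_eq, eq_exp hs]
  refine h.deriv.trans ?_
  simp

lemma quadratic_lt_exp {z : ℝ} (hz : -(4 / 15) ≤ z) :
    z ^ 2 / 2 + 34 / 15 * z - 97 / 225 < Real.exp z := by
  rcases le_or_gt 0 z with h | h
  · have hexp := Real.sum_le_exp_of_nonneg h 5
    simp [Finset.sum_range_succ, Nat.factorial] at hexp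
    nlinarith [sq_nonneg (z ^ 2 - 3 / 2), sq_nonneg (z - 13 / 10),
      mul_nonneg h (sq_nonneg (z - 13 / 10))]
  · nlinarith [Real.exp_pos z]

lemma radial_deriv_pos {y s : ℝ} (hy : y ^ 2 ≤ s) :
    0 < 1 + stretchProfile s + 2 * y ^ 2 * deriv stretchProfile s := by
  rcases le_or_gt 1 s with h | h
  · rw [eq_zero h, deriv_of_one_le h]
    norm_num
  · rw [deriv_of_lt_one h]
    have ht : 0 < 1 - s := by linarith
    obtain ⟨w, hw⟩ : ∃ w, w = 1 / (1 - s) := ⟨_, rfl⟩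
    have hw1 : 1 ≤ w := by
      rw [hw, le_div_iff₀ ht]
      nlinarith [sq_nonneg y]
    have hsw : s * w ^ 2 = w ^ 2 - w := by
      rw [hw]
      field_simp
      ring
    have hdiv : 4 / (1 - s) ^ 2 = 4 * w ^ 2 := by
      rw [hw]
      field_simp
    have hρ : stretchProfile s = Real.exp (64 / 15 - 4 * w) := by
      rw [eq_exp h, hw]
      ring_nf
    have hlt := quadratic_lt_exp (z := 4 * w - 64 / 15) (by linarith)
    have hmul : stretchProfile s * Real.exp (4 * w - 64 / 15) = 1 := by
      rw [hρ, ← Real.exp_add]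
      simp
    have hpos : 0 < stretchProfile s := by
      rw [hρ]
      exact Real.exp_pos _
    have hle : y ^ 2 * w ^ 2 ≤ w ^ 2 - w := by
      rw [← hsw]
      gcongr
    rw [hdiv]
    nlinarith [mul_lt_mul_of_pos_left hlt hpos, mul_le_mul_of_nonneg_left hle hpos.le]

end stretchProfile

/-- The map `(x, y) ↦ (x / 2, y / 2 * (1 + ρ (x ^ 2 + y ^ 2)))`, where `ρ` is
`stretchProfile`. -/
noncomputable def segmentMap (p : EuclideanSpace ℝ (Fin 2)) : EuclideanSpace ℝ (Fin 2) :=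
  (2 : ℝ)⁻¹ • p +
    (2⁻¹ * (stretchProfile (p 0 ^ 2 + p 1 ^ 2) * p 1)) • EuclideanSpace.single 1 (1 : ℝ)

namespace segmentMap

@[simp]
lemma apply_zero (p : EuclideanSpace ℝ (Fin 2)) : segmentMap p 0 = p 0 / 2 := by
  simp [segmentMap]
  ring

@[simp]
lemma apply_one (p : EuclideanSpace ℝ (Fin 2)) :
    segmentMap p 1 = p 1 / 2 * (1 + stretchProfile (p 0 ^ 2 + p 1 ^ 2)) := by
  simp [segmentMap]
  ring

protected lemma contDiff {n : ℕ∞} : ContDiff ℝ n segmentMap := by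
  have h0 : ContDiff ℝ n fun p : EuclideanSpace ℝ (Fin 2) => p 0 :=
    (EuclideanSpace.proj (𝕜 := ℝ) (0 : Fin 2)).contDiff
  have h1 : ContDiff ℝ n fun p : EuclideanSpace ℝ (Fin 2) => p 1 :=
    (EuclideanSpace.proj (𝕜 := ℝ) (1 : Fin 2)).contDiff
  exact (contDiff_id.const_smul _).add
    ((contDiff_const.mul ((stretchProfile.contDiff.comp ((h0.pow 2).add (h1.pow 2))).mul
      h1)).smul contDiff_const)

lemma exists_hasFDerivAt_equiv (p : EuclideanSpace ℝ (Fin 2)) :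
    ∃ L : EuclideanSpace ℝ (Fin 2) ≃L[ℝ] EuclideanSpace ℝ (Fin 2),
      HasFDerivAt segmentMap (L : EuclideanSpace ℝ (Fin 2) →L[ℝ] EuclideanSpace ℝ (Fin 2)) p := by
  have h0 : HasFDerivAt (fun p : EuclideanSpace ℝ (Fin 2) => p 0)
      (EuclideanSpace.proj (𝕜 := ℝ) (0 : Fin 2)) p :=
    (EuclideanSpace.proj (𝕜 := ℝ) (0 : Fin 2)).hasFDerivAt
  have h1 : HasFDerivAt (fun p : EuclideanSpace ℝ (Fin 2) => p 1)
      (EuclideanSpace.proj (𝕜 := ℝ) (1 : Fin 2)) p :=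
    (EuclideanSpace.proj (𝕜 := ℝ) (1 : Fin 2)).hasFDerivAt
  have h := ((hasFDerivAt_id p).const_smul (2 : ℝ)⁻¹).add
    (((((stretchProfile.hasDerivAt _).comp_hasFDerivAt p ((h0.pow 2).add (h1.pow 2))).mul
      h1).const_mul 2⁻¹).smul_const (EuclideanSpace.single (1 : Fin 2) (1 : ℝ)))
  obtain ⟨D, hD⟩ : ∃ D, HasFDerivAt segmentMap D p ∧ ∀ v, D v = 0 → v = 0 := by
    refine ⟨_, h, fun v hv => ?_⟩
    have e0 := congrArg (fun q : EuclideanSpace ℝ (Fin 2) => q 0) hv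
    have e1 := congrArg (fun q : EuclideanSpace ℝ (Fin 2) => q 1) hv
    simp at e0 e1
    have hpos := stretchProfile.radial_deriv_pos (y := p 1) (s := p 0 ^ 2 + p 1 ^ 2)
      (by nlinarith [sq_nonneg (p 0)])
    have hv1 : v 1 = 0 := by
      refine (mul_eq_zero.1 (?_ : (1 + stretchProfile (p 0 ^ 2 + p 1 ^ 2) +
        2 * p 1 ^ 2 * deriv stretchProfile (p 0 ^ 2 + p 1 ^ 2)) * v 1 = 0)).resolve_left hpos.ne'
      rw [e0] at e1
      linear_combination 2 * e1
    ext i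
    fin_cases i
    · exact e0
    · exact hv1
  have hinj : Function.Injective (D : EuclideanSpace ℝ (Fin 2) →ₗ[ℝ] EuclideanSpace ℝ (Fin 2)) :=
    (injective_iff_map_eq_zero _).2 hD.2
  refine ⟨(LinearEquiv.ofInjectiveEndo _ hinj).toContinuousLinearEquiv, hD.1.congr_fderiv ?_⟩
  ext v : 1
  rfl

lemma isOpenMap : IsOpenMap segmentMap := by
  rw [isOpenMap_iff_nhds_le]
  intro p
  obtain ⟨L, hL⟩ := exists_hasFDerivAt_equiv p
  exact (((segmentMap.contDiff (n := 1)).contDiffAt.hasStrictFDerivAt' hL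
    (by norm_num)).map_nhds_eq_of_equiv).ge

lemma strictMono_vertical (x : ℝ) :
    StrictMono fun y => y / 2 * (1 + stretchProfile (x ^ 2 + y ^ 2)) := by
  refine strictMono_of_deriv_pos fun y => ?_
  have h := ((hasDerivAt_id' y).div_const 2).mul (((stretchProfile.hasDerivAt _).comp y
    (((hasDerivAt_id' y).pow 2).const_add (x ^ 2))).const_add 1)
  have hpos := stretchProfile.radial_deriv_pos (y := y) (s := x ^ 2 + y ^ 2)
    (by nlinarith [sq_nonneg x])
  refine lt_of_lt_of_eq ?_ h.deriv.symm
  simp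
  linarith

lemma surjective_vertical (x : ℝ) :
    Function.Surjective fun y => y / 2 * (1 + stretchProfile (x ^ 2 + y ^ 2)) := by
  have hcont : Continuous stretchProfile := (stretchProfile.contDiff (n := 0)).continuous
  refine Continuous.surjective (by fun_prop) ?_ ?_
  · refine Filter.tendsto_atTop_mono' _ ?_ (Filter.tendsto_id.atTop_div_const two_pos)
    filter_upwards [Filter.eventually_ge_atTop 0] with y hy
    have := stretchProfile.nonneg (x ^ 2 + y ^ 2)
    simp only [id]
    nlinarith [mul_nonneg hy this]
  · refine Filter.tendsto_atBot_mono' _ ?_ (Filter.tendsto_id.atBot_div_const two_pos)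
    filter_upwards [Filter.eventually_le_atBot 0] with y hy
    have := stretchProfile.nonneg (x ^ 2 + y ^ 2)
    simp only [id]
    nlinarith [mul_nonneg (neg_nonneg.2 hy) this]

lemma bijective : Function.Bijective segmentMap := by
  refine ⟨fun p q hpq => ?_, fun q => ?_⟩
  · have e0 := congrArg (fun q : EuclideanSpace ℝ (Fin 2) => q 0) hpq
    have e1 := congrArg (fun q : EuclideanSpace ℝ (Fin 2) => q 1) hpq
    simp only [apply_zero, apply_one] at e0 e1
    have h0 : p 0 = q 0 := by linarith
    rw [h0] at e1
    ext i
    fin_cases i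
    · exact h0
    · exact (strictMono_vertical (q 0)).injective e1
  · obtain ⟨y, hy⟩ := surjective_vertical (2 * q 0) (q 1)
    refine ⟨!₂[2 * q 0, y], ?_⟩
    ext i
    fin_cases i
    · simp
    · simpa using hy

lemma eq_half_smul {p : EuclideanSpace ℝ (Fin 2)} (hp : p ∉ ball 0 1) :
    segmentMap p = (2 : ℝ)⁻¹ • p := by
  have h : 1 ≤ p 0 ^ 2 + p 1 ^ 2 := by
    rw [mem_ball_zero_iff, not_lt] at hp
    have := EuclideanSpace.real_norm_sq_eq p
    rw [Fin.sum_univ_two] at this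
    nlinarith
  simp [segmentMap, stretchProfile.eq_zero h]

lemma mem_ball {p : EuclideanSpace ℝ (Fin 2)} (hp : p ∈ closedBall 0 1) :
    segmentMap p ∈ ball 0 1 := by
  rw [mem_closedBall_zero_iff] at hp
  rw [mem_ball_zero_iff, ← sq_lt_one_iff₀ (norm_nonneg _)]
  have hn := EuclideanSpace.real_norm_sq_eq p
  have hs : p 0 ^ 2 + p 1 ^ 2 ≤ 1 := by
    rw [Fin.sum_univ_two] at hn
    nlinarith [norm_nonneg p]
  rw [EuclideanSpace.real_norm_sq_eq, Fin.sum_univ_two, apply_zero, apply_one]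
  set s := p 0 ^ 2 + p 1 ^ 2 with hsdef
  have h0 : 0 ≤ stretchProfile s := stretchProfile.nonneg s
  have hs0 : 0 ≤ s := by positivity
  rcases le_or_gt s (1 / 16) with h | h
  · have h2 := stretchProfile.le_two hs0
    have : (1 + stretchProfile s) ^ 2 ≤ 9 := by nlinarith
    nlinarith [mul_le_mul_of_nonneg_left this (sq_nonneg (p 1)), sq_nonneg (p 0)]
  · have h2 := stretchProfile.lt_one h
    have : (1 + stretchProfile s) ^ 2 < 4 := by nlinarith
    rcases eq_or_ne (p 1) 0 with h1 | h1
    · rw [h1] at hsdef ⊢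
      nlinarith
    · nlinarith [mul_lt_mul_of_pos_left this (by positivity : 0 < p 1 ^ 2), sq_nonneg (p 0)]

/-- Outside the strip `|y| ≤ 1 / 4`, `segmentMap` strictly decreases `|y|`. -/
lemma abs_apply_one_lt {p : EuclideanSpace ℝ (Fin 2)} (h : 1 / 4 < |p 1|) :
    |segmentMap p 1| < |p 1| := by
  have hs : 1 / 16 < p 0 ^ 2 + p 1 ^ 2 := by nlinarith [sq_abs (p 1), sq_nonneg (p 0)]
  have h1 := stretchProfile.lt_one hs
  have h0 := stretchProfile.nonneg (p 0 ^ 2 + p 1 ^ 2)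
  rw [apply_one, abs_mul, abs_div, abs_two, abs_of_pos (by linarith : 0 < 1 + stretchProfile _)]
  nlinarith

/-- On the vertical axis, `segmentMap` preserves the segment `|y| ≤ 1 / 4` and its complement. -/
lemma apply_one_mem_Icc_iff {p : EuclideanSpace ℝ (Fin 2)} (hp : p 0 = 0) :
    segmentMap p 1 ∈ Icc (-(1 / 4) : ℝ) (1 / 4) ↔ p 1 ∈ Icc (-(1 / 4) : ℝ) (1 / 4) := by
  have hval := stretchProfile.apply_one_div_sixteen
  have hR : (1 / 4 : ℝ) / 2 * (1 + stretchProfile (0 ^ 2 + (1 / 4) ^ 2)) = 1 / 4 := by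
    norm_num at hval ⊢
    rw [hval]
    norm_num
  have hL : (-(1 / 4) : ℝ) / 2 * (1 + stretchProfile (0 ^ 2 + (-(1 / 4)) ^ 2)) = -(1 / 4) := by
    norm_num at hval ⊢
    rw [hval]
    norm_num
  have h1 := (strictMono_vertical 0).le_iff_le (a := p 1) (b := 1 / 4)
  have h2 := (strictMono_vertical 0).le_iff_le (a := -(1 / 4)) (b := p 1)
  simp only [hR, hL] at h1 h2
  rw [apply_one, hp, mem_Icc, mem_Icc, h1, h2]

end segmentMap

/-- The homeomorphism of the plane underlying `segmentMap`. -/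
noncomputable def segmentHomeomorph :
    EuclideanSpace ℝ (Fin 2) ≃ₜ EuclideanSpace ℝ (Fin 2) :=
  (Equiv.ofBijective segmentMap segmentMap.bijective).toHomeomorphOfContinuousOpen
    (segmentMap.contDiff (n := 0)).continuous segmentMap.isOpenMap

lemma coe_segmentHomeomorph : ⇑segmentHomeomorph = segmentMap := rfl

lemma contDiff_segmentHomeomorph_symm {n : ℕ∞} : ContDiff ℝ n segmentHomeomorph.symm := by
  choose L hL using segmentMap.exists_hasFDerivAt_equiv
  exact segmentHomeomorph.contDiff_symm hL segmentMap.contDiff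

/-- A compact set in the plane that is contained in its image under `segmentMap` is contained in
the segment. -/
lemma subset_segment_of_subset_image {K : Set (EuclideanSpace ℝ (Fin 2))} (hK : IsCompact K)
    (h : K ⊆ segmentMap '' K) : K ⊆ {p | p 0 = 0 ∧ p 1 ∈ Icc (-(1 / 4) : ℝ) (1 / 4)} := by
  have hzero : ∀ p ∈ K, p 0 = 0 := by
    intro p hp
    obtain ⟨m, hm, hmax⟩ := hK.exists_isMaxOn ⟨p, hp⟩
      (f := fun q : EuclideanSpace ℝ (Fin 2) => |q 0|) (by fun_prop)
    obtain ⟨q, hq, rfl⟩ := h hm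
    have hqm : |q 0| ≤ |segmentMap q 0| := hmax hq
    have hpm : |p 0| ≤ |segmentMap q 0| := hmax hp
    rw [segmentMap.apply_zero, abs_div, abs_two] at hqm hpm
    exact abs_nonpos_iff.1 (by linarith)
  intro p hp
  refine ⟨hzero p hp, ?_⟩
  obtain ⟨m, hm, hmax⟩ := hK.exists_isMaxOn ⟨p, hp⟩
    (f := fun q : EuclideanSpace ℝ (Fin 2) => |q 1|) (by fun_prop)
  obtain ⟨q, hq, rfl⟩ := h hm
  have hqm : |q 1| ≤ |segmentMap q 1| := hmax hq
  have hpm : |p 1| ≤ |segmentMap q 1| := hmax hp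
  have hq4 : |q 1| ≤ 1 / 4 := not_lt.1 fun hlt => (segmentMap.abs_apply_one_lt hlt).not_ge hqm
  have hmem := (segmentMap.apply_one_mem_Icc_iff (hzero q hq)).2 (mem_Icc.2 (abs_le.1 hq4))
  exact mem_Icc.2 (abs_le.1 (hpm.trans (abs_le.2 (mem_Icc.1 hmem))))

lemma segment_subset_image :
    {p : EuclideanSpace ℝ (Fin 2) | p 0 = 0 ∧ p 1 ∈ Icc (-(1 / 4) : ℝ) (1 / 4)} ⊆
      segmentMap '' {p | p 0 = 0 ∧ p 1 ∈ Icc (-(1 / 4) : ℝ) (1 / 4)} := by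
  rintro p ⟨hp0, hp1⟩
  obtain ⟨q, rfl⟩ := segmentMap.bijective.surjective p
  have hq0 : q 0 = 0 := by
    rw [segmentMap.apply_zero] at hp0
    linarith
  exact ⟨q, ⟨hq0, (segmentMap.apply_one_mem_Icc_iff hq0).1 hp1⟩, rfl⟩

lemma segment_subset_closedBall :
    {p : EuclideanSpace ℝ (Fin 2) | p 0 = 0 ∧ p 1 ∈ Icc (-(1 / 4) : ℝ) (1 / 4)} ⊆
      closedBall 0 1 := by
  rintro p ⟨hp0, hp1, hp2⟩
  rw [mem_closedBall_zero_iff, ← sq_le_one_iff₀ (norm_nonneg _), EuclideanSpace.real_norm_sq_eq,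
    Fin.sum_univ_two, hp0]
  nlinarith

/-- If `f` is injective, the maximal invariant set `⋂ n, f^[n] '' C` is contained in its image. -/
lemma iInter_iterate_image_subset_image {α : Type*} {f : α → α} (hf : Injective f) (C : Set α) :
    ⋂ n : ℕ, f^[n] '' C ⊆ f '' ⋂ n : ℕ, f^[n] '' C := by
  intro p hp
  rw [mem_iInter] at hp
  obtain ⟨r, -, hr⟩ := hp 1
  refine ⟨r, mem_iInter.2 fun n => ?_, hr⟩
  obtain ⟨t, ht, htp⟩ := hp (n + 1)
  rw [iterate_succ_apply'] at htp
  exact ⟨t, ht, hf (htp.trans hr.symm)⟩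

lemma subset_iterate_image {α : Type*} {f : α → α} {S : Set α} (h : S ⊆ f '' S) (n : ℕ) :
    S ⊆ f^[n] '' S := by
  induction n with
  | zero => simp
  | succ n ih =>
    rw [iterate_succ, image_comp]
    exact ih.trans (image_mono h)

/-- There is a smooth diffeomorphism of the plane equal to the homothety `x ↦ x/2`
outside the unit ball, trapping the closed unit ball, and whose maximal invariant
set in the closed unit ball is the vertical segment `{0} × [-1/4, 1/4]`. -/
theorem exists_smooth_diffeo_with_segment_attractor :
    ∃ F : EuclideanSpace ℝ (Fin 2) ≃ EuclideanSpace ℝ (Fin 2),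
      ContDiff ℝ (⊤ : ℕ∞) F ∧ ContDiff ℝ (⊤ : ℕ∞) F.symm ∧
      (∀ x ∉ Metric.ball (0 : EuclideanSpace ℝ (Fin 2)) 1, F x = (2 : ℝ)⁻¹ • x) ∧
      F '' closure (Metric.ball (0 : EuclideanSpace ℝ (Fin 2)) 1) ⊆
        Metric.ball (0 : EuclideanSpace ℝ (Fin 2)) 1 ∧
      (⋂ n : ℕ, (⇑F)^[n] '' closure (Metric.ball (0 : EuclideanSpace ℝ (Fin 2)) 1)) =
        {p : EuclideanSpace ℝ (Fin 2) | p 0 = 0 ∧ p 1 ∈ Set.Icc (-(1 / 4) : ℝ) (1 / 4)} := by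
  rw [closure_ball _ one_ne_zero]
  refine ⟨segmentHomeomorph.toEquiv, segmentMap.contDiff, contDiff_segmentHomeomorph_symm,
    fun x hx => segmentMap.eq_half_smul hx, ?_, ?_⟩
  · rintro _ ⟨p, hp, rfl⟩
    exact segmentMap.mem_ball hp
  · change ⋂ n : ℕ, segmentMap^[n] '' closedBall 0 1 = _
    have hcont : Continuous segmentMap := (segmentMap.contDiff (n := 0)).continuous
    refine Subset.antisymm (subset_segment_of_subset_image ?_
      (iInter_iterate_image_subset_image segmentMap.bijective.injective _))
      (subset_iInter fun n => (subset_iterate_image segment_subset_image n).trans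
        (image_mono segment_subset_closedBall))
    have hcomp (n : ℕ) : IsCompact (segmentMap^[n] '' closedBall 0 1) :=
      (isCompact_closedBall 0 1).image (hcont.iterate n)
    exact (hcomp 0).of_isClosed_subset (isClosed_iInter fun n => (hcomp n).isClosed)
      (iInter_subset _ 0)
end

section
/- Let X be a compact metric space with distance d and let h : X → X be a homeomorphism which is expansive with constant α > 0, that is: for all x, y ∈ X, if d(hⁿ(x), hⁿ(y)) ≤ α for every n ∈ ℤ then x = y. Then for every ε with 0 < ε < α, the diameters of the images of ε-stable sets contract uniformly: for every δ > 0 there exists N ≥ 0 such that for every x ∈ X, every y ∈ X with d(hⁿ(x), hⁿ(y)) ≤ ε for all n ≥ 0, and every n ≥ N, one has d(hⁿ(x), hⁿ(y)) ≤ δ. -/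
open Set

theorem Homeomorph.continuous_toEquiv_zpow {X : Type*} [TopologicalSpace X] (h : X ≃ₜ X)
    (m : ℤ) : Continuous ((h.toEquiv : Equiv.Perm X) ^ m) := by
  cases m with
  | ofNat n =>
    rw [Int.ofNat_eq_natCast, zpow_natCast, ← Equiv.Perm.iterate_eq_pow]
    exact h.continuous.iterate n
  | negSucc n =>
    rw [zpow_negSucc, ← inv_pow, ← Equiv.Perm.iterate_eq_pow]
    exact h.symm.continuous.iterate (n + 1)

/-- Two points whose orbits stay `α`-close from time `-N` on are `δ`-close, for `N` large
depending only on `δ`. -/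
theorem exists_forall_dist_lt_of_expansive {X : Type*} [MetricSpace X] [CompactSpace X]
    (h : X ≃ₜ X) {α : ℝ}
    (hexp : ∀ x y : X, (∀ n : ℤ, dist ((h.toEquiv ^ n) x) ((h.toEquiv ^ n) y) ≤ α) → x = y)
    {δ : ℝ} (hδ : 0 < δ) :
    ∃ N : ℕ, ∀ u v : X,
      (∀ m : ℤ, -(N : ℤ) ≤ m → dist ((h.toEquiv ^ m) u) ((h.toEquiv ^ m) v) ≤ α) →
      dist u v < δ := by
  by_contra! hne
  let K : ℕ → Set (X × X) := fun N =>
    {p | (∀ m : ℤ, -(N : ℤ) ≤ m → dist ((h.toEquiv ^ m) p.1) ((h.toEquiv ^ m) p.2) ≤ α) ∧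
      δ ≤ dist p.1 p.2}
  have hclosed (N : ℕ) : IsClosed (K N) := by
    refine IsClosed.and ?_ (isClosed_le continuous_const continuous_dist)
    simp only [ofPred_forall]
    refine isClosed_iInter fun m => isClosed_iInter fun _ => isClosed_le ?_ continuous_const
    exact ((h.continuous_toEquiv_zpow m).comp continuous_fst).dist
      ((h.continuous_toEquiv_zpow m).comp continuous_snd)
  obtain ⟨p, hp⟩ := IsCompact.nonempty_iInter_of_sequence_nonempty_isCompact_isClosed K
    (fun N p hp => ⟨fun m hm => hp.1 m (by push_cast; lia), hp.2⟩)
    (fun N => let ⟨u, v, huv⟩ := hne N; ⟨(u, v), huv⟩)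
    (hclosed 0).isCompact hclosed
  rw [mem_iInter] at hp
  have heq : p.1 = p.2 := hexp _ _ fun m => (hp m.natAbs).1 m (by lia)
  have hle := (hp 0).2
  rw [heq, dist_self] at hle
  exact hle.not_gt hδ

/-- For an expansive homeomorphism of a compact metric space with expansivity
constant `α`, the diameters of forward images of `ε`-stable sets (for `ε < α`)
contract to zero uniformly. -/
theorem expansive_stable_sets_contract_uniformly
    (X : Type*) [MetricSpace X] [CompactSpace X] (h : X ≃ₜ X)
    (α : ℝ) (hα : 0 < α)
    (hexp : ∀ x y : X, (∀ n : ℤ, dist ((h.toEquiv ^ n) x) ((h.toEquiv ^ n) y) ≤ α) → x = y) :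
    ∀ ε : ℝ, 0 < ε → ε < α → ∀ δ : ℝ, 0 < δ → ∃ N : ℕ, ∀ x y : X,
      (∀ n : ℕ, dist ((⇑h)^[n] x) ((⇑h)^[n] y) ≤ ε) →
      ∀ n : ℕ, N ≤ n → dist ((⇑h)^[n] x) ((⇑h)^[n] y) ≤ δ := by
  intro ε _ hεα δ hδ
  obtain ⟨N, hN⟩ := exists_forall_dist_lt_of_expansive h hexp hδ
  refine ⟨N, fun x y hxy n hn => (hN _ _ fun m hm => ?_).le⟩
  obtain ⟨k, hk⟩ := Int.eq_ofNat_of_zero_le (show 0 ≤ m + n by lia)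
  have hiter (z : X) : (h.toEquiv ^ m) ((⇑h)^[n] z) = (⇑h)^[k] z := by
    have hpow (j : ℕ) : (⇑h)^[j] z = ((h.toEquiv : Equiv.Perm X) ^ (j : ℤ)) z := by
      rw [zpow_natCast, ← Equiv.Perm.iterate_eq_pow]
      rfl
    rw [hpow, hpow, ← Equiv.Perm.mul_apply, ← zpow_add, hk]
  rw [hiter, hiter]
  exact (hxy k).trans hεα.le
end
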